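/- Let M be a connected topological r-manifold and let g be a homeomorphism of M of finite order whose fixed point set has nonempty interior in M. Then g is the identity. -/

import Mathlib

/-- The group of self-homeomorphisms of a topological space, with composition
as multiplication: `(f * g) x = f (g x)`. -/
instance homeoGroup (X : Type*) [TopologicalSpace X] : Group (X ≃ₜ X) where
  one := Homeomorph.refl X
  mul f g := g.trans f
  inv := Homeomorph.symm
  mul_assoc f g h := rfl
  one_mul f := Homeomorph.ext fun _ => rfl
  mul_one f := Homeomorph.ext fun _ => rfl
  inv_mul_cancel f := Homeomorph.ext fun x => f.symm_apply_apply x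

lemma homeo_one_apply {X : Type*} [TopologicalSpace X] (x : X) :
    (1 : X ≃ₜ X) x = x := rfl

namespace Newman

section

variable {A B : Type*}

/-- The coboundary of a cochain on lists, each face being weighted by the value of `c` at the
omitted vertex. -/
def wdl (c : A → ℤ) : (List A → ℤ) → List A → ℤ
  | _, [] => 0
  | Φ, x :: l => c x * Φ l - wdl c (fun m => Φ (x :: m)) l

/-- The simplicial coboundary of a cochain on lists. -/
abbrev dl (Φ : List A → ℤ) : List A → ℤ := wdl (fun _ => 1) Φ

/-- The prism operator between two maps, dualised to cochains. -/
def prism (a b : A → B) : (List B → ℤ) → List A → ℤ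
  | _, [] => 0
  | Φ, x :: l => Φ (a x :: b x :: l.map b) - prism a b (fun m => Φ (a x :: m)) l

lemma wdl_congr {c c' : A → ℤ} {Φ Φ' : List A → ℤ} {l : List A} (hc : ∀ x ∈ l, c x = c' x)
    (h : ∀ m, m.Sublist l → m.length + 1 = l.length → Φ m = Φ' m) : wdl c Φ l = wdl c' Φ' l := by
  induction l generalizing Φ Φ' with
  | nil => rfl
  | cons x l ih =>
    simp only [wdl]
    rw [hc x (by simp), h l (List.sublist_cons_self x l) (by simp),
      ih (fun y hy => hc y (by simp [hy])) fun m hm hlen => h _ (hm.cons_cons x) (by simp [hlen])]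

lemma wdl_zero (c : A → ℤ) (l : List A) : wdl c (fun _ => 0) l = 0 := by
  induction l with
  | nil => rfl
  | cons x l ih => simp [wdl, ih]

lemma wdl_eq_zero {c : A → ℤ} {Φ : List A → ℤ} {l : List A}
    (h : ∀ m, m.Sublist l → m.length + 1 = l.length → Φ m = 0) : wdl c Φ l = 0 := by
  rw [wdl_congr (fun _ _ => rfl) h, wdl_zero]

lemma wdl_weight_zero {c : A → ℤ} {Φ : List A → ℤ} {l : List A} (h : ∀ x ∈ l, c x = 0) :
    wdl c Φ l = 0 := by
  induction l generalizing Φ with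
  | nil => rfl
  | cons x l ih => simp [wdl, h x, ih fun y hy => h y (by simp [hy])]

lemma wdl_sub (c : A → ℤ) (Φ Φ' : List A → ℤ) (l : List A) :
    wdl c (fun m => Φ m - Φ' m) l = wdl c Φ l - wdl c Φ' l := by
  induction l generalizing Φ Φ' with
  | nil => rfl
  | cons x l ih => simp only [wdl, ih]; ring

lemma wdl_const_mul (c : A → ℤ) (k : ℤ) (Φ : List A → ℤ) (l : List A) :
    wdl c (fun m => k * Φ m) l = k * wdl c Φ l := by
  induction l generalizing Φ with
  | nil => simp [wdl]
  | cons x l ih => simp only [wdl, ih]; ring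

lemma wdl_neg (c : A → ℤ) (Φ : List A → ℤ) (l : List A) :
    wdl c (fun m => -Φ m) l = -wdl c Φ l := by
  simpa using wdl_const_mul c (-1) Φ l

lemma wdl_sum {ι : Type*} (s : Finset ι) (c : A → ℤ) (Φ : ι → List A → ℤ) (l : List A) :
    wdl c (fun m => ∑ i ∈ s, Φ i m) l = ∑ i ∈ s, wdl c (Φ i) l := by
  induction l generalizing Φ with
  | nil => simp [wdl]
  | cons x l ih => simp only [wdl, ih, Finset.sum_sub_distrib, Finset.mul_sum]

lemma wdl_weight_sum {ι : Type*} (s : Finset ι) (c : ι → A → ℤ) (Φ : List A → ℤ) (l : List A) :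
    wdl (fun x => ∑ i ∈ s, c i x) Φ l = ∑ i ∈ s, wdl (c i) Φ l := by
  induction l generalizing Φ with
  | nil => simp [wdl]
  | cons x l ih => simp only [wdl, ih, Finset.sum_sub_distrib, Finset.sum_mul]

lemma wdl_weight_add (c c' : A → ℤ) (Φ : List A → ℤ) (l : List A) :
    wdl (fun x => c x + c' x) Φ l = wdl c Φ l + wdl c' Φ l := by
  induction l generalizing Φ with
  | nil => simp [wdl]
  | cons x l ih => simp only [wdl, ih]; ring

lemma wdl_map (c : B → ℤ) (a : A → B) (Φ : List B → ℤ) (l : List A) :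
    wdl c Φ (l.map a) = wdl (fun x => c (a x)) (fun m => Φ (m.map a)) l := by
  induction l generalizing Φ with
  | nil => rfl
  | cons x l ih => simp only [wdl, ih, List.map_cons]

lemma wdl_anticomm (c c' : A → ℤ) (Φ : List A → ℤ) (l : List A) :
    wdl c (wdl c' Φ) l = -wdl c' (wdl c Φ) l := by
  induction l generalizing Φ with
  | nil => rfl
  | cons x l ih =>
    simp only [wdl, wdl_sub, wdl_const_mul, ih]
    ring

lemma wdl_self (c : A → ℤ) (Φ : List A → ℤ) (l : List A) : wdl c (wdl c Φ) l = 0 := by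
  have := wdl_anticomm c c Φ l
  omega

lemma prism_congr {a b : A → B} {Φ Φ' : List B → ℤ} {l : List A}
    (h : ∀ u x w, l = u ++ x :: w → Φ (u.map a ++ a x :: b x :: w.map b) =
      Φ' (u.map a ++ a x :: b x :: w.map b)) : prism a b Φ l = prism a b Φ' l := by
  induction l generalizing Φ Φ' with
  | nil => rfl
  | cons x l ih =>
    simp only [prism]
    have h0 : Φ (a x :: b x :: l.map b) = Φ' (a x :: b x :: l.map b) := h [] x l rfl
    rw [h0, ih (Φ' := fun m => Φ' (a x :: m)) fun u y w hl => h (x :: u) y w (by simp [hl])]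

lemma prism_zero (a b : A → B) (l : List A) : prism a b (fun _ => 0) l = 0 := by
  induction l with
  | nil => rfl
  | cons x l ih => simp [prism, ih]

lemma prism_eq_zero {a b : A → B} {Φ : List B → ℤ} {l : List A}
    (h : ∀ u x w, l = u ++ x :: w → Φ (u.map a ++ a x :: b x :: w.map b) = 0) :
    prism a b Φ l = 0 := by
  rw [prism_congr (Φ' := fun _ => 0) h, prism_zero]

lemma prism_sub (a b : A → B) (Φ Φ' : List B → ℤ) (l : List A) :
    prism a b (fun m => Φ m - Φ' m) l = prism a b Φ l - prism a b Φ' l := by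
  induction l generalizing Φ Φ' with
  | nil => rfl
  | cons x l ih => simp only [prism, ih]; ring

lemma prism_const_mul (a b : A → B) (k : ℤ) (Φ : List B → ℤ) (l : List A) :
    prism a b (fun m => k * Φ m) l = k * prism a b Φ l := by
  induction l generalizing Φ with
  | nil => simp [prism]
  | cons x l ih => simp only [prism, ih]; ring

lemma prism_neg (a b : A → B) (Φ : List B → ℤ) (l : List A) :
    prism a b (fun m => -Φ m) l = -prism a b Φ l := by
  simpa using prism_const_mul a b (-1) Φ l

lemma prism_sum {ι : Type*} (s : Finset ι) (a b : A → B) (Φ : ι → List B → ℤ) (l : List A) :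
    prism a b (fun m => ∑ i ∈ s, Φ i m) l = ∑ i ∈ s, prism a b (Φ i) l := by
  induction l generalizing Φ with
  | nil => simp [prism]
  | cons x l ih => simp only [prism, ih, Finset.sum_sub_distrib]

/-- The prism operator is a chain homotopy. -/
lemma prism_dl (a b : A → B) (Φ : List B → ℤ) (l : List A) :
    prism a b (dl Φ) l = Φ (l.map b) - Φ (l.map a) - dl (prism a b Φ) l := by
  induction l generalizing Φ with
  | nil => simp [prism, wdl]
  | cons x l ih =>
    have := ih fun m => Φ (a x :: m)
    simp only [prism, dl, wdl, wdl_sub, prism_sub, wdl_map, List.map_cons, one_mul] at this ⊢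
    rw [this]
    ring

/-- Prism operators in commuting directions anticommute. -/
lemma prism_prism {a b c d : A → A} (hac : ∀ x, a (c x) = c (a x)) (had : ∀ x, a (d x) = d (a x))
    (hbc : ∀ x, b (c x) = c (b x)) (hbd : ∀ x, b (d x) = d (b x)) (Φ : List A → ℤ) (l : List A) :
    prism a b (prism c d Φ) l = -prism c d (prism a b Φ) l := by
  have hmap : ∀ (e f g : A → A) (_ : ∀ x, f (e x) = e (f x)) (_ : ∀ x, g (e x) = e (g x))
      (Ψ : List A → ℤ) (l : List A),
      prism f g Ψ (l.map e) = prism f g (fun m => Ψ (m.map e)) l := by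
    intro e f g hf hg Ψ l
    induction l generalizing Ψ with
    | nil => rfl
    | cons x l ih =>
      simp only [prism, List.map_cons, ih, List.map_map, hf, hg]
      congr 3
      simp [Function.comp_def, hg]
  induction l generalizing Φ with
  | nil => rfl
  | cons x l ih =>
    have := ih fun m => Φ (a (c x) :: m)
    have h1 := hmap b c d (fun x => (hbc x).symm) (fun x => (hbd x).symm)
    have h2 := hmap d a b had hbd
    simp only [prism, prism_sub, List.map_cons, List.map_map, Function.comp_def, h1, h2, hbd, hac,
      had, hbc] at this ⊢
    rw [this]
    ring

end

section

variable {A B : Type*}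

/-- Cochains which change sign when two adjacent entries are swapped. -/
def IsAlt (Φ : List A → ℤ) : Prop :=
  ∀ u x y w, Φ (u ++ x :: y :: w) = -Φ (u ++ y :: x :: w)

lemma IsAlt.cons {Φ : List A → ℤ} (h : IsAlt Φ) (z : A) : IsAlt fun m => Φ (z :: m) :=
  fun u x y w => h (z :: u) x y w

lemma IsAlt.wdl {Φ : List A → ℤ} (h : IsAlt Φ) (c : A → ℤ) : IsAlt (wdl c Φ) := by
  intro u x y w
  induction u generalizing Φ with
  | nil =>
    have h1 : (fun m => Φ (x :: y :: m)) = fun m => -Φ (y :: x :: m) :=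
      funext fun m => h [] x y m
    simp only [Newman.wdl, List.nil_append, h1, wdl_neg]
    ring
  | cons z u ih =>
    have h1 := h u x y w
    simp only [Newman.wdl, List.cons_append, h1, ih (h.cons z)]
    ring

lemma IsAlt.perm_eq_zero {Φ : List A → ℤ} (h : IsAlt Φ) {l m : List A} (hp : l.Perm m)
    (hl : Φ l = 0) : Φ m = 0 := by
  induction hp generalizing Φ with
  | nil => exact hl
  | cons x _ ih => exact ih (h.cons x) hl
  | swap x y w =>
    have := h [] x y w
    simp only [List.nil_append] at this
    omega
  | trans _ _ ih1 ih2 => exact ih2 h (ih1 h hl)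

lemma IsAlt.eq_zero_of_not_nodup {Φ : List A → ℤ} (h : IsAlt Φ) {l : List A} (hl : ¬ l.Nodup) :
    Φ l = 0 := by
  obtain ⟨x, hx⟩ := List.exists_duplicate_iff_not_nodup.2 hl
  obtain ⟨m, hm⟩ := (List.duplicate_iff_sublist.1 hx).exists_perm_append
  refine h.perm_eq_zero hm.symm ?_
  have := h [] x x m
  simp only [List.nil_append, List.cons_append] at this ⊢
  omega

/-- The determinant of the matrix of the values of the functions `cs` at the entries of a list,
expanded along the columns; it is `0` when the lengths differ. -/
def Alt : List (A → ℤ) → List A → ℤ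
  | [], l => if l.isEmpty then 1 else 0
  | c :: cs, l => wdl c (Alt cs) l

lemma Alt_cons (c : A → ℤ) (cs : List (A → ℤ)) : Alt (c :: cs) = wdl c (Alt cs) := by
  funext l; simp [Alt]

lemma isAlt_Alt (cs : List (A → ℤ)) : IsAlt (Alt cs) := by
  induction cs with
  | nil => intro u x y w; simp [Alt]
  | cons c cs ih => rw [Alt_cons]; exact ih.wdl c

lemma wdl_length {c : A → ℤ} {Φ : List A → ℤ} {l : List A} {n : ℕ}
    (h : ∀ m, Φ m ≠ 0 → m.length = n) (hl : wdl c Φ l ≠ 0) : l.length = n + 1 := by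
  by_contra hne
  refine hl (wdl_eq_zero fun m _ hm => ?_)
  by_contra h0
  have := h m h0
  omega

lemma Alt_length {cs : List (A → ℤ)} {l : List A} (h : Alt cs l ≠ 0) : l.length = cs.length := by
  induction cs generalizing l with
  | nil => simpa [Alt] using h
  | cons c cs ih => rw [Alt_cons] at h; exact wdl_length (fun m hm => ih hm) h

lemma exists_mem_of_Alt_ne_zero {cs : List (A → ℤ)} {l : List A} (h : Alt cs l ≠ 0) {c : A → ℤ}
    (hc : c ∈ cs) : ∃ x ∈ l, c x ≠ 0 := by
  induction cs generalizing l with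
  | nil => simp at hc
  | cons c' cs ih =>
    rw [Alt_cons] at h
    by_contra! hx
    rcases List.mem_cons.1 hc with rfl | hc
    · exact h (wdl_weight_zero hx)
    · refine h (wdl_eq_zero fun m hm _ => ?_)
      by_contra h0
      obtain ⟨x, hxm, hcx⟩ := ih h0 hc
      exact hcx (hx x (hm.subset hxm))

lemma exists_col_of_Alt_ne_zero {cs : List (A → ℤ)} {l : List A} (h : Alt cs l ≠ 0) {x : A}
    (hx : x ∈ l) : ∃ c ∈ cs, c x ≠ 0 := by
  induction cs generalizing l with
  | nil =>
    rcases l with - | ⟨y, l⟩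
    · simp at hx
    · simp [Alt] at h
  | cons c cs ih =>
    by_contra! hc
    classical
    refine h ((isAlt_Alt _).perm_eq_zero (List.perm_cons_erase hx).symm ?_)
    rw [Alt_cons]
    have : ∀ m, Alt cs (x :: m) = 0 := by
      intro m
      by_contra h0
      obtain ⟨c', hc', h1⟩ := ih h0 (by simp)
      exact h1 (hc c' (by simp [hc']))
    simp [wdl, hc c (by simp), this, wdl_zero]

lemma Alt_map (a : A → B) (cs : List (B → ℤ)) (l : List A) :
    Alt cs (l.map a) = Alt (cs.map fun c x => c (a x)) l := by
  induction cs generalizing l with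
  | nil => simp [Alt]
  | cons c cs ih => simp only [Alt_cons, List.map_cons, wdl_map, ih]

lemma wdl_Alt_eq_zero {cs : List (A → ℤ)} {c : A → ℤ} (h : c ∈ cs) (l : List A) :
    wdl c (Alt cs) l = 0 := by
  induction cs generalizing l with
  | nil => simp at h
  | cons c' cs ih =>
    rw [Alt_cons]
    rcases List.mem_cons.1 h with rfl | h
    · exact wdl_self _ _ _
    · rw [wdl_anticomm, wdl_eq_zero fun m _ _ => ih h m, neg_zero]

lemma wdl_list_sum_eq_zero {cs : List (A → ℤ)} {Φ : List A → ℤ} {l : List A}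
    (h : ∀ c ∈ cs, wdl c Φ l = 0) : wdl (fun x => (cs.map fun c => c x).sum) Φ l = 0 := by
  induction cs with
  | nil => exact wdl_weight_zero (by simp)
  | cons c cs ih =>
    simp only [List.map_cons, List.sum_cons]
    rw [wdl_weight_add c fun x => (cs.map fun c => c x).sum, h c (by simp),
      ih fun c hc => h c (by simp [hc]), add_zero]

lemma dl_Alt_eq_zero {cs : List (A → ℤ)} (h : ∀ x, (cs.map fun c => c x).sum = 1) (l : List A) :
    dl (Alt cs) l = 0 := by
  have := wdl_list_sum_eq_zero (l := l) fun c (hc : c ∈ cs) => wdl_Alt_eq_zero hc l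
  simpa only [h] using this

/-! ### The cup product -/

/-- The cup product, the first factor having degree `k`. -/
def cup (k : ℕ) (α β : List A → ℤ) (l : List A) : ℤ := α (l.take (k + 1)) * β (l.drop k)

lemma dl_cup (k : ℕ) (α β : List A → ℤ) (l : List A) (hl : k + 2 ≤ l.length) :
    dl (cup k α β) l = dl α (l.take (k + 2)) * β (l.drop (k + 1)) +
      (-1) ^ k * (α (l.take (k + 1)) * dl β (l.drop k)) := by
  induction k generalizing α l with
  | zero =>
    rcases l with - | ⟨x, - | ⟨y, l⟩⟩
    · simp at hl
    · simp at hl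
    · have : ∀ m, cup 0 α β (x :: m) = α [x] * β (x :: m) := fun m => by simp [cup]
      simp only [dl, wdl, this, wdl_const_mul]
      simp [cup, wdl]
      ring
  | succ k ih =>
    rcases l with - | ⟨x, l⟩
    · simp at hl
    · have h1 : ∀ m, cup (k + 1) α β (x :: m) = cup k (fun m => α (x :: m)) β m :=
        fun m => by simp [cup]
      have h2 := ih (fun m => α (x :: m)) l (by simpa using hl)
      simp only [dl, wdl, h1, List.take_succ_cons, List.drop_succ_cons] at h2 ⊢
      rw [h2]
      simp only [cup]
      ring

/-- Slanting a cup product along a direction which the second factor does not see. -/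
lemma prism_cup {a b : A → A} {β : List A → ℤ} (hb : ∀ l, β (l.map b) = β l)
    (h0 : ∀ u x w, β (u ++ a x :: b x :: w) = 0) (k : ℕ) (α : List A → ℤ) (l : List A) :
    prism a b (cup (k + 1) α β) l = cup k (prism a b α) β l := by
  induction l generalizing k α with
  | nil => simp [prism, cup]
  | cons x l ih =>
    have h1 : ∀ m, cup (k + 1) α β (a x :: m) = cup k (fun m => α (a x :: m)) β m :=
      fun m => by simp [cup]
    simp only [prism, h1]
    rcases k with - | k
    · rw [prism_eq_zero fun u y w _ => by simp only [cup, List.drop_zero, h0, mul_zero]]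
      have := hb (x :: l)
      simp only [List.map_cons] at this
      simp [cup, prism, this]
    · rw [ih k]
      have := hb (l.drop k)
      simp [cup, prism, ← List.map_take, ← List.map_drop, this, sub_mul]

end

section

variable {A : Type*} {D : Type*}

/-- The slant product of a cochain on the integer lattice with the subdivided segment `[-N, N]` in
direction `d`. -/
noncomputable def slant [DecidableEq D] (N : ℤ) (d : D) (Φ : List (D → ℤ) → ℤ) (l : List (D → ℤ)) :
    ℤ :=
  ∑ t ∈ Finset.Ico (-N) N, prism (fun z => Function.update z d t)
    (fun z => Function.update z d (t + 1)) Φ l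

/-- The slant product of a cochain with the Kuhn triangulation of a cube with directions `ds`. -/
noncomputable def cube [DecidableEq D] (N : ℤ) : List D → (List (D → ℤ) → ℤ) → List (D → ℤ) → ℤ
  | [], Φ => Φ
  | d :: ds, Φ => cube N ds (slant N d Φ)

/-- Lists of lattice points which may occur in a simplex of the cube through `z₀` with
directions `ds`. -/
structure Adm (N : ℤ) (z₀ : D → ℤ) (ds : List D) (l : List (D → ℤ)) : Prop where
  bound : ∀ z ∈ l, ∀ d, |z d| ≤ N
  close : ∀ z ∈ l, ∀ w ∈ l, ∀ d, |z d - w d| ≤ 1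
  eq_of_notMem : ∀ z ∈ l, ∀ d, d ∉ ds → z d = z₀ d

lemma Adm.sublist {N : ℤ} {z₀ : D → ℤ} {ds : List D} {l m : List (D → ℤ)} (h : Adm N z₀ ds l)
    (hm : m ⊆ l) : Adm N z₀ ds m :=
  ⟨fun z hz => h.bound z (hm hz), fun z hz w hw => h.close z (hm hz) w (hm hw),
    fun z hz => h.eq_of_notMem z (hm hz)⟩

lemma adm_singleton {N : ℤ} {z₀ : D → ℤ} (h : ∀ d, |z₀ d| ≤ N) (ds : List D) :
    Adm N z₀ ds [z₀] := by
  constructor <;> simp [h]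

/-- `m` is obtained from `l` by moving each point to the `t`-th or `(t+1)`-st layer in
direction `d`. -/
lemma Adm.layer [DecidableEq D] {N : ℤ} {z₀ : D → ℤ} {d : D} {ds : List D} {l m : List (D → ℤ)}
    (h : Adm N z₀ ds l) {t : ℤ} (ht : -N ≤ t) (ht' : t < N)
    (hm : ∀ w ∈ m, ∃ z ∈ l, w = Function.update z d t ∨ w = Function.update z d (t + 1)) :
    Adm N z₀ (d :: ds) m := by
  have key : ∀ w ∈ m, (w d = t ∨ w d = t + 1) ∧ ∃ z ∈ l, ∀ e, e ≠ d → w e = z e := by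
    intro w hw
    obtain ⟨z, hz, rfl | rfl⟩ := hm w hw
    · exact ⟨by simp, z, hz, fun e he => by simp [he]⟩
    · exact ⟨by simp, z, hz, fun e he => by simp [he]⟩
  constructor
  · intro w hw e
    obtain ⟨hd, z, hz, hwz⟩ := key w hw
    by_cases he : e = d
    · subst he; rw [abs_le]; omega
    · rw [hwz e he]; exact h.bound z hz e
  · intro w hw w' hw' e
    obtain ⟨hd, z, hz, hwz⟩ := key w hw
    obtain ⟨hd', z', hz', hwz'⟩ := key w' hw'
    by_cases he : e = d
    · subst he; rw [abs_le]; omega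
    · rw [hwz e he, hwz' e he]; exact h.close z hz z' hz' e
  · intro w hw e he
    obtain ⟨-, z, hz, hwz⟩ := key w hw
    simp only [List.mem_cons, not_or] at he
    rw [hwz e he.1]; exact h.eq_of_notMem z hz e he.2

lemma mem_prism_list {B : Type*} {a b : A → B} {l u w : List A} {x : A} (hl : l = u ++ x :: w)
    {y : B} (hy : y ∈ u.map a ++ a x :: b x :: w.map b) : ∃ z ∈ l, y = a z ∨ y = b z := by
  subst hl
  simp only [List.mem_append, List.mem_map, List.mem_cons] at hy
  rcases hy with ⟨z, hz, rfl⟩ | rfl | rfl | ⟨z, hz, rfl⟩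
  · exact ⟨z, by simp [hz], Or.inl rfl⟩
  · exact ⟨x, by simp, Or.inl rfl⟩
  · exact ⟨x, by simp, Or.inr rfl⟩
  · exact ⟨z, by simp [hz], Or.inr rfl⟩

lemma slant_congr [DecidableEq D] {N : ℤ} {z₀ : D → ℤ} {d : D} {ds : List D}
    {Φ Φ' : List (D → ℤ) → ℤ}
    {l : List (D → ℤ)} (hl : Adm N z₀ ds l)
    (h : ∀ m, Adm N z₀ (d :: ds) m → m.length = l.length + 1 → Φ m = Φ' m) :
    slant N d Φ l = slant N d Φ' l := by
  refine Finset.sum_congr rfl fun t ht => prism_congr fun u x w hlu => h _ ?_ (by simp [hlu]; omega)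
  rw [Finset.mem_Ico] at ht
  exact hl.layer ht.1 ht.2 fun y hy => mem_prism_list hlu hy

lemma cube_congr [DecidableEq D] {N : ℤ} {z₀ : D → ℤ} {ds : List D} {Φ Φ' : List (D → ℤ) → ℤ}
    {l : List (D → ℤ)} (hl : Adm N z₀ [] l)
    (h : ∀ m, Adm N z₀ ds m → m.length = ds.length + l.length → Φ m = Φ' m) :
    cube N ds Φ l = cube N ds Φ' l := by
  induction ds generalizing Φ Φ' with
  | nil => exact h l hl (by simp)
  | cons d ds ih =>
    exact ih fun m hm hlen => slant_congr hm fun m' hm' hlen' => h m' hm' (by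
      simp only [List.length_cons]; omega)

lemma slant_sub [DecidableEq D] (N : ℤ) (d : D) (Φ Φ' : List (D → ℤ) → ℤ) (l : List (D → ℤ)) :
    slant N d (fun m => Φ m - Φ' m) l = slant N d Φ l - slant N d Φ' l := by
  simp [slant, prism_sub]

lemma slant_const_mul [DecidableEq D] (N : ℤ) (d : D) (k : ℤ) (Φ : List (D → ℤ) → ℤ)
    (l : List (D → ℤ)) :
    slant N d (fun m => k * Φ m) l = k * slant N d Φ l := by
  simp [slant, prism_const_mul, Finset.mul_sum]

lemma slant_sum [DecidableEq D] {ι : Type*} (s : Finset ι) (N : ℤ) (d : D)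
    (Φ : ι → List (D → ℤ) → ℤ)
    (l : List (D → ℤ)) :
    slant N d (fun m => ∑ i ∈ s, Φ i m) l = ∑ i ∈ s, slant N d (Φ i) l := by
  simp only [slant, prism_sum]
  exact Finset.sum_comm

lemma cube_sub [DecidableEq D] (N : ℤ) (ds : List D) (Φ Φ' : List (D → ℤ) → ℤ) (l : List (D → ℤ)) :
    cube N ds (fun m => Φ m - Φ' m) l = cube N ds Φ l - cube N ds Φ' l := by
  induction ds generalizing Φ Φ' with
  | nil => rfl
  | cons d ds ih => simp only [cube, ← ih, funext (slant_sub N d Φ Φ')]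

lemma cube_const_mul [DecidableEq D] (N : ℤ) (ds : List D) (k : ℤ) (Φ : List (D → ℤ) → ℤ)
    (l : List (D → ℤ)) :
    cube N ds (fun m => k * Φ m) l = k * cube N ds Φ l := by
  induction ds generalizing Φ with
  | nil => rfl
  | cons d ds ih => simp only [cube, ← ih, funext (slant_const_mul N d k Φ)]

lemma cube_neg [DecidableEq D] (N : ℤ) (ds : List D) (Φ : List (D → ℤ) → ℤ) (l : List (D → ℤ)) :
    cube N ds (fun m => -Φ m) l = -cube N ds Φ l := by
  simpa using cube_const_mul N ds (-1) Φ l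

lemma cube_sum [DecidableEq D] {ι : Type*} (s : Finset ι) (N : ℤ) (ds : List D)
    (Φ : ι → List (D → ℤ) → ℤ)
    (l : List (D → ℤ)) :
    cube N ds (fun m => ∑ i ∈ s, Φ i m) l = ∑ i ∈ s, cube N ds (Φ i) l := by
  induction ds generalizing Φ with
  | nil => rfl
  | cons d ds ih => simp only [cube, ← ih, funext (slant_sum s N d Φ)]

lemma cube_append [DecidableEq D] (N : ℤ) (ds es : List D) (Φ : List (D → ℤ) → ℤ) :
    cube N (ds ++ es) Φ = cube N es (cube N ds Φ) := by
  induction ds generalizing Φ with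
  | nil => rfl
  | cons d ds ih => simp only [cube, List.cons_append, ih]

lemma slant_slant [DecidableEq D] (N : ℤ) {d e : D} (h : d ≠ e) (Φ : List (D → ℤ) → ℤ)
    (l : List (D → ℤ)) :
    slant N e (slant N d Φ) l = -slant N d (slant N e Φ) l := by
  have h1 : ∀ s t : ℤ, ∀ z : D → ℤ, Function.update (Function.update z e t) d s =
      Function.update (Function.update z d s) e t :=
    fun s t z => Function.update_comm h.symm _ _ _
  have h2 : ∀ t ∈ Finset.Ico (-N) N, prism (fun z => Function.update z e t)
      (fun z => Function.update z e (t + 1)) (slant N d Φ) l =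
      ∑ s ∈ Finset.Ico (-N) N, -prism (fun z => Function.update z d s)
        (fun z => Function.update z d (s + 1)) (prism (fun z => Function.update z e t)
        (fun z => Function.update z e (t + 1)) Φ) l := by
    intro t _
    unfold slant
    rw [prism_sum]
    refine Finset.sum_congr rfl fun s _ => prism_prism ?_ ?_ ?_ ?_ Φ l <;>
    · intro z; simp only [h1]
  have h3 : ∀ s ∈ Finset.Ico (-N) N, prism (fun z => Function.update z d s)
      (fun z => Function.update z d (s + 1)) (slant N e Φ) l =
      ∑ t ∈ Finset.Ico (-N) N, prism (fun z => Function.update z d s)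
        (fun z => Function.update z d (s + 1)) (prism (fun z => Function.update z e t)
        (fun z => Function.update z e (t + 1)) Φ) l := by
    intro t _
    unfold slant
    rw [prism_sum]
  have h2' : slant N e (slant N d Φ) l = _ := Finset.sum_congr rfl h2
  have h3' : slant N d (slant N e Φ) l = _ := Finset.sum_congr rfl h3
  rw [h2', h3', Finset.sum_comm]
  simp only [Finset.sum_neg_distrib]

/-- Permuting the directions changes the cube by a sign. -/
lemma cube_perm [DecidableEq D] (N : ℤ) {ds es : List D} (h : ds.Perm es) (hd : ds.Nodup) :
    ∃ ε : ℤ, ε * ε = 1 ∧ ∀ (Φ : List (D → ℤ) → ℤ) l, cube N ds Φ l = ε * cube N es Φ l := by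
  induction h with
  | nil => exact ⟨1, by simp, by simp⟩
  | cons d _ ih =>
    obtain ⟨ε, h1, h2⟩ := ih hd.of_cons
    exact ⟨ε, h1, fun Φ l => h2 _ l⟩
  | swap d e w =>
    refine ⟨-1, by simp, fun Φ l => ?_⟩
    have hne : e ≠ d := by
      rintro rfl
      simp at hd
    simp only [cube, funext (slant_slant N hne Φ), cube_neg]
    ring
  | trans h12 _ ih1 ih2 =>
    obtain ⟨ε, h1, h2⟩ := ih1 hd
    obtain ⟨ε', h1', h2'⟩ := ih2 (h12.nodup_iff.1 hd)
    refine ⟨ε * ε', by linear_combination ε' * ε' * h1 + h1', fun Φ l => ?_⟩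
    rw [h2, h2']
    ring

lemma slant_dl [DecidableEq D] (N : ℤ) (hN : 0 ≤ N) (d : D) (Φ : List (D → ℤ) → ℤ)
    (l : List (D → ℤ)) :
    slant N d (dl Φ) l = Φ (l.map fun z => Function.update z d N) -
      Φ (l.map fun z => Function.update z d (-N)) - dl (slant N d Φ) l := by
  unfold slant
  simp only [prism_dl, Finset.sum_sub_distrib]
  rw [dl, wdl_sum]
  congr 1
  rw [← Finset.sum_sub_distrib]
  have : ∀ k : ℕ, ∑ t ∈ Finset.Ico (-N) (-N + k), (Φ (l.map fun z => Function.update z d (t + 1)) -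
      Φ (l.map fun z => Function.update z d t)) =
      Φ (l.map fun z => Function.update z d (-N + k)) -
      Φ (l.map fun z => Function.update z d (-N)) := by
    intro k
    induction k with
    | zero => simp
    | succ k ih =>
      have : Finset.Ico (-N) (-N + (k + 1 : ℕ)) =
          insert (-N + (k : ℤ)) (Finset.Ico (-N) (-N + k)) := by
        ext t; simp only [Finset.mem_Ico, Finset.mem_insert]; push_cast; omega
      rw [this, Finset.sum_insert (by simp), ih]
      push_cast
      rw [← add_assoc]
      ring
  have h := this (2 * N).toNat
  rwa [show -N + ((2 * N).toNat : ℤ) = N by omega] at h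

/-- Lists contained in a face of the cube. -/
def OnBdry (N : ℤ) (ds : List D) (l : List (D → ℤ)) : Prop := ∃ d ∈ ds, ∀ z ∈ l, |z d| = N

/-- The Stokes formula for the cube. -/
lemma cube_dl_eq_zero [DecidableEq D] {N : ℤ} (hN : 0 ≤ N) {z₀ : D → ℤ} (hz : ∀ d, |z₀ d| ≤ N)
    {ds : List D}
    (hds : ds.Nodup) {Ψ : List (D → ℤ) → ℤ} (h0 : Ψ [] = 0)
    (h : ∀ l, Adm N z₀ ds l → OnBdry N ds l → l.length = ds.length → Ψ l = 0) :
    cube N ds (dl Ψ) [z₀] = 0 := by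
  induction ds generalizing Ψ with
  | nil => simp [cube, wdl, h0]
  | cons d ds ih =>
    rw [List.nodup_cons] at hds
    rw [cube, cube_congr (Φ' := fun l => -dl (slant N d Ψ) l) (adm_singleton hz []), cube_neg,
      ih hds.2, neg_zero]
    · simp [slant, prism]
    · intro l hl ⟨e, he, hb⟩ hlen
      refine Finset.sum_eq_zero fun t ht => prism_eq_zero fun u x w hlu => h _ ?_ ?_ ?_
      · rw [Finset.mem_Ico] at ht
        exact hl.layer ht.1 ht.2 fun y hy => mem_prism_list hlu hy
      · refine ⟨e, by simp [he], fun y hy => ?_⟩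
        have hne : e ≠ d := fun h => hds.1 (h ▸ he)
        obtain ⟨z, hz, rfl | rfl⟩ := mem_prism_list (a := fun z => Function.update z d t)
          (b := fun z => Function.update z d (t + 1)) hlu hy
        · simp [hne, hb z hz]
        · simp [hne, hb z hz]
      · simp [← hlen, hlu]; omega
    · intro l hl hlen
      have key : ∀ t : ℤ, |t| = N → (Ψ (l.map fun z => Function.update z d t)) = 0 := by
        intro t ht
        refine h _ ⟨?_, ?_, ?_⟩ ⟨d, by simp, ?_⟩ (by simpa using hlen)
        · intro w hw e
          obtain ⟨z, hz, rfl⟩ := List.mem_map.1 hw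
          by_cases he : e = d
          · subst he; simp [ht]
          · simpa [he] using hl.bound z hz e
        · intro w hw w' hw' e
          obtain ⟨z, hz, rfl⟩ := List.mem_map.1 hw
          obtain ⟨z', hz', rfl⟩ := List.mem_map.1 hw'
          by_cases he : e = d
          · subst he; simp
          · simpa [he] using hl.close z hz z' hz' e
        · intro w hw e he
          obtain ⟨z, hz, rfl⟩ := List.mem_map.1 hw
          simp only [List.mem_cons, not_or] at he
          simpa [he.1] using hl.eq_of_notMem z hz e he.2
        · intro w hw
          obtain ⟨z, hz, rfl⟩ := List.mem_map.1 hw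
          simp [ht]
      rw [slant_dl N hN, key N (abs_of_nonneg hN), key (-N) (by rw [abs_neg, abs_of_nonneg hN])]
      ring

/-- Homotopy invariance of the integral of a cochain over the cube. -/
lemma cube_homotopy [DecidableEq D] {N : ℤ} (hN : 0 ≤ N) {z₀ : D → ℤ} (hz : ∀ d, |z₀ d| ≤ N)
    {ds : List D}
    (hds : ds.Nodup) (a b : (D → ℤ) → A) (Ψ : List A → ℤ)
    (h : ∀ l, Adm N z₀ ds l → ∀ u x w, l = u ++ x :: w → l.length = ds.length + 1 →
      dl Ψ (u.map a ++ a x :: b x :: w.map b) = 0)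
    (hb : ∀ l, Adm N z₀ ds l → OnBdry N ds l → ∀ u x w, l = u ++ x :: w → l.length = ds.length →
      Ψ (u.map a ++ a x :: b x :: w.map b) = 0) :
    cube N ds (fun l => Ψ (l.map a)) [z₀] = cube N ds (fun l => Ψ (l.map b)) [z₀] := by
  have h1 := cube_dl_eq_zero hN hz hds (Ψ := prism a b Ψ) rfl fun l hl hbd hlen =>
    prism_eq_zero fun u x w hlu => hb l hl hbd u x w hlu hlen
  rw [cube_congr (Φ' := fun l => Ψ (l.map b) - Ψ (l.map a)) (adm_singleton hz []), cube_sub] at h1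
  · omega
  · intro l hl hlen
    have := prism_dl a b Ψ l
    rw [prism_eq_zero fun u x w hlu => h l hl u x w hlu (by simpa using hlen)] at this
    omega

/-- Integrating a cup product over directions which the second factor does not see. -/
lemma cube_cup [DecidableEq D] {N : ℤ} {ds : List D} {β : List (D → ℤ) → ℤ}
    (hb : ∀ d ∈ ds, ∀ t l, β (l.map fun z => Function.update z d t) = β l)
    (h0 : ∀ d ∈ ds, ∀ (s t : ℤ) (u : List (D → ℤ)) (x : D → ℤ) (w : List (D → ℤ)),
      β (u ++ Function.update x d s :: Function.update x d t :: w) = 0)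
    (α : List (D → ℤ) → ℤ) (l : List (D → ℤ)) :
    cube N ds (cup ds.length α β) l = cube N ds α (l.take 1) * β l := by
  induction ds generalizing α with
  | nil => simp [cube, cup]
  | cons d ds ih =>
    have : slant N d (cup (ds.length + 1) α β) = cup ds.length (slant N d α) β := by
      funext l
      simp only [slant, cup, Finset.sum_mul]
      refine Finset.sum_congr rfl fun t _ => ?_
      exact prism_cup (hb d (by simp) _) (fun u x w => h0 d (by simp) _ _ u x w) _ α l
    simp only [cube, List.length_cons, this]
    exact ih (fun e he => hb e (by simp [he])) (fun e he => h0 e (by simp [he])) _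

end

section

variable {A B : Type*} {D : Type*} {K : Type*}

/-- The indicator function of a point, with integer values. -/
def ind [DecidableEq A] (s x : A) : ℤ := if x = s then 1 else 0

/-- The first entry of `L` satisfying `p`, if any. -/
noncomputable def firstLabel (L : List K) (p : K → Prop) : Option K :=
  open Classical in L.find? fun k => decide (p k)

/-- The determinant cochain detecting simplices on which all labels from `L`, and the empty label,
occur. -/
def labelForm [DecidableEq K] (L : List K) : List (Option K) → ℤ :=
  Alt (L.map (fun k => ind (some k)) ++ [ind none])

lemma labelForm_cons [DecidableEq K] (k : K) (L : List K) : labelForm (k :: L) = wdl (ind (some k))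
    (labelForm L) := by
  rw [labelForm, List.map_cons, List.cons_append, Alt_cons, labelForm]

lemma firstLabel_cons_pos {k : K} {L : List K} {p : K → Prop} (h : p k) :
    firstLabel (k :: L) p = some k := by simp [firstLabel, h]

lemma firstLabel_cons_neg {k : K} {L : List K} {p : K → Prop} (h : ¬ p k) :
    firstLabel (k :: L) p = firstLabel L p := by simp [firstLabel, h]

lemma firstLabel_eq_some {k : K} {L : List K} {p : K → Prop} (h : firstLabel L p = some k) :
    p k ∧ k ∈ L := by
  classical
  have h' : L.find? (fun k => decide (p k)) = some k := by rw [← h, firstLabel]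
  exact ⟨by simpa using List.find?_some h', List.mem_of_find?_eq_some h'⟩

lemma firstLabel_eq_none {L : List K} {p : K → Prop} (h : firstLabel L p = none) :
    ∀ k ∈ L, ¬ p k := by
  simpa [firstLabel] using h

lemma firstLabel_congr {L : List K} {p q : K → Prop} (h : ∀ k ∈ L, (p k ↔ q k)) :
    firstLabel L p = firstLabel L q := by
  induction L with
  | nil => rfl
  | cons k L ih =>
    have ih := ih fun j hj => h j (by simp [hj])
    have hk := h k (by simp)
    by_cases hp : p k
    · rw [firstLabel_cons_pos hp, firstLabel_cons_pos (hk.1 hp)]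
    · rw [firstLabel_cons_neg hp, firstLabel_cons_neg (fun hq => hp (hk.2 hq)), ih]

lemma labelForm_rainbow [DecidableEq K] {L : List K} {p : A → K → Prop} {l : List A}
    (h : labelForm L (l.map fun x => firstLabel L (p x)) ≠ 0) :
    l.length = L.length + 1 ∧ (∀ k ∈ L, ∃ x ∈ l, p x k) ∧ ∃ x ∈ l, ∀ k ∈ L, ¬ p x k := by
  refine ⟨by simpa using Alt_length h, fun k hk => ?_, ?_⟩
  · obtain ⟨y, hy, hc⟩ := exists_mem_of_Alt_ne_zero h (c := ind (some k))
      (List.mem_append_left _ (List.mem_map.2 ⟨k, hk, rfl⟩))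
    obtain ⟨x, hx, rfl⟩ := List.mem_map.1 hy
    exact ⟨x, hx, (firstLabel_eq_some (by simpa [ind] using hc)).1⟩
  · obtain ⟨y, hy, hc⟩ := exists_mem_of_Alt_ne_zero h (c := ind none) (by simp)
    obtain ⟨x, hx, rfl⟩ := List.mem_map.1 hy
    exact ⟨x, hx, firstLabel_eq_none (by simpa [ind] using hc)⟩

lemma dl_labelForm (n : ℕ) (l : List (Option (Fin n))) :
    dl (labelForm (List.finRange n)) l = 0 := by
  refine dl_Alt_eq_zero (fun x => ?_) l
  have := Fin.sum_univ_def fun k : Fin n => ind (some k) x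
  simp only [List.map_append, List.map_map, Function.comp_def, List.map_cons, List.map_nil,
    List.sum_append, List.sum_cons, List.sum_nil, ← this]
  rcases x with - | k
  · simp [ind]
  · simp [ind]

lemma prism_wdl_eq_neg {a b : A → B} {c : B → ℤ} {Ψ : List B → ℤ} (ha : ∀ x, c (a x) = 0)
    (hb : ∀ x, c (b x) = 1) (hΨ : ∀ m x, b x ∈ m → Ψ m = 0) {l : List A} (hl : l ≠ []) :
    prism a b (wdl c Ψ) l = -Ψ (l.map a) := by
  induction l generalizing Ψ with
  | nil => exact absurd rfl hl
  | cons x l ih =>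
    have h1 : wdl c (fun m => Ψ (a x :: b x :: m)) (l.map b) = 0 :=
      wdl_eq_zero fun m _ _ => hΨ _ x (by simp)
    simp only [prism, wdl, ha, hb, zero_mul, zero_sub, prism_neg, h1, one_mul]
    rcases l with - | ⟨y, l⟩
    · simp [prism]
    · rw [ih (fun m z hz => hΨ _ z (by simp [hz])) (by simp), hΨ _ y (by simp)]
      simp

lemma slant_labelForm [DecidableEq D] [DecidableEq K] {N : ℤ} {k : K} {L : List K} {ι : K → D}
    (hL : (k :: L).Nodup)
    (hι : ∀ i ∈ k :: L, ∀ j ∈ k :: L, ι i = ι j → i = j) {θ : K → ℤ} (h1 : -N ≤ θ k)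
    (h2 : θ k < N) {l : List (D → ℤ)} (hl : l ≠ []) :
    slant N (ι k) (fun m => labelForm (k :: L)
      (m.map fun z => firstLabel (k :: L) fun i => θ i < z (ι i))) l =
      -labelForm L (l.map fun z => firstLabel L fun i => θ i < z (ι i)) := by
  set lab : (D → ℤ) → Option K := fun z => firstLabel (k :: L) fun i => θ i < z (ι i) with hlab
  set c : (D → ℤ) → ℤ := fun z => ind (some k) (lab z)
  set Ψ : List (D → ℤ) → ℤ := fun m => labelForm L (m.map lab)
  have hw : (fun m => labelForm (k :: L) (m.map lab)) = wdl c Ψ := by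
    funext m
    rw [labelForm_cons, wdl_map]
  have hkL : k ∉ L := (List.nodup_cons.1 hL).1
  have hpos : ∀ z, θ k < z (ι k) → c z = 1 := fun z hz => by
    simp only [c, hlab, firstLabel_cons_pos (p := fun i => θ i < z (ι i)) hz, ind, if_true]
  have hneg : ∀ z, ¬ θ k < z (ι k) → c z = 0 := fun z hz => by
    simp only [c, hlab, firstLabel_cons_neg (p := fun i => θ i < z (ι i)) hz, ind]
    rw [if_neg]
    intro h
    exact hkL (firstLabel_eq_some h).2
  have hΨ : ∀ m z, z ∈ m → θ k < z (ι k) → Ψ m = 0 := by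
    intro m z hz hk
    by_contra h0
    obtain ⟨f, hf, hfz⟩ := exists_col_of_Alt_ne_zero h0 (x := some k)
      (List.mem_map.2 ⟨z, hz, firstLabel_cons_pos (p := fun i => θ i < z (ι i)) hk⟩)
    simp only [List.mem_append, List.mem_map, List.mem_singleton] at hf
    rcases hf with ⟨j, hj, rfl⟩ | rfl
    · rcases eq_or_ne k j with rfl | hne
      · exact hkL hj
      · simp [ind, hne] at hfz
    · simp [ind] at hfz
  rw [hw, slant, Finset.sum_eq_single (θ k)]
  · rw [prism_wdl_eq_neg (fun z => hneg _ (by simp)) (fun z => hpos _ (by simp))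
      (fun m z hz => hΨ m _ hz (by simp)) hl]
    simp only [Ψ, List.map_map]
    congr 2
    refine List.map_congr_left fun z _ => ?_
    simp only [Function.comp_apply, hlab]
    rw [firstLabel_cons_neg (by simp)]
    refine firstLabel_congr fun i hi => ?_
    rw [Function.update_of_ne]
    intro h
    exact hkL ((hι i (by simp [hi]) k (by simp) h) ▸ hi)
  · intro t _ ht
    refine prism_eq_zero fun u x w hlu => ?_
    rcases lt_or_gt_of_ne ht with h | h
    · refine wdl_weight_zero fun y hy => hneg _ ?_
      obtain ⟨z, -, rfl | rfl⟩ := mem_prism_list (a := fun z => Function.update z (ι k) t)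
          (b := fun z => Function.update z (ι k) (t + 1)) hlu hy
      · simp; omega
      · simp; omega
    · refine wdl_eq_zero fun m hm hlen => ?_
      obtain ⟨y, hy⟩ := List.exists_mem_of_length_pos (l := m) (by
        simp only [List.length_append, List.length_map, List.length_cons] at hlen; omega)
      refine hΨ m y hy ?_
      obtain ⟨z, -, rfl | rfl⟩ := mem_prism_list (a := fun z => Function.update z (ι k) t)
          (b := fun z => Function.update z (ι k) (t + 1)) hlu (hm.subset hy)
      · simp; omega
      · simp; omega
  · intro h
    simp only [Finset.mem_Ico] at h
    omega

/-- The identity map of the cube has degree one. -/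
lemma cube_labelForm [DecidableEq D] [DecidableEq K] {N : ℤ} {z₀ : D → ℤ} (hz : ∀ d, |z₀ d| ≤ N)
    {L : List K} {ι : K → D}
    (hL : L.Nodup) (hι : ∀ i ∈ L, ∀ j ∈ L, ι i = ι j → i = j) {θ : K → ℤ}
    (h1 : ∀ k ∈ L, -N ≤ θ k ∧ θ k < N) :
    cube N (L.map ι) (fun m => labelForm L
      (m.map fun z => firstLabel L fun i => θ i < z (ι i))) [z₀] = (-1) ^ L.length := by
  induction L with
  | nil => simp [cube, labelForm, Alt_cons, firstLabel, wdl, ind, Alt]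
  | cons k L ih =>
    rw [List.map_cons, cube, cube_congr (adm_singleton hz []) fun m _ hlen =>
      slant_labelForm hL hι (h1 k (by simp)).1 (h1 k (by simp)).2 (List.ne_nil_of_length_pos
        (by rw [hlen]; simp)), cube_neg, ih hL.of_cons
        (fun i hi j hj => hι i (by simp [hi]) j (by simp [hj])) fun i hi => h1 i (by simp [hi])]
    simp [pow_succ]

/-- Lists whose entries take the labels prescribed by `L`. -/
noncomputable def labelledLists [DecidableEq K] [DecidableEq A] (s : Finset A) (lab : A → K) :
    List K → Finset (List A)
  | [] => {[]}
  | k :: L => ((s.filter fun x => lab x = k) ×ˢ labelledLists s lab L).image fun q => q.1 :: q.2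

lemma mem_labelledLists [DecidableEq K] [DecidableEq A] {s : Finset A} {lab : A → K} {L : List K}
    {σ : List A} :
    σ ∈ labelledLists s lab L ↔ (∀ x ∈ σ, x ∈ s) ∧ σ.map lab = L := by
  induction L generalizing σ with
  | nil => simp only [labelledLists, Finset.mem_singleton, List.map_eq_nil_iff]; aesop
  | cons k L ih =>
    simp only [labelledLists, Finset.mem_image, Finset.mem_product, Finset.mem_filter, ih,
      Prod.exists]
    constructor
    · rintro ⟨x, τ, ⟨⟨hx, rfl⟩, hτ, rfl⟩, rfl⟩
      simpa [hx] using hτ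
    · rcases σ with - | ⟨x, τ⟩
      · simp
      · intro ⟨h1, h2⟩
        simp only [List.map_cons, List.cons.injEq] at h2
        exact ⟨x, τ, ⟨⟨h1 x (by simp), h2.1⟩, fun y hy => h1 y (by simp [hy]), h2.2⟩, rfl⟩

/-- Multilinear expansion of a determinant of indicators of labels. -/
lemma Alt_label_expand [DecidableEq K] [DecidableEq A] (s : Finset A) (lab : A → K) (L : List K)
    {l : List A}
    (hl : ∀ x ∈ l, x ∈ s) :
    Alt (L.map ind) (l.map lab) = ∑ σ ∈ labelledLists s lab L, Alt (σ.map ind) l := by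
  induction L generalizing l with
  | nil => simp [labelledLists, Alt]
  | cons k L ih =>
    have h1 : ∀ x ∈ l, ind k (lab x) = ∑ y ∈ s.filter (fun y => lab y = k), ind y x := by
      intro x hx
      simp [ind, hl x hx]
    rw [List.map_cons, Alt_cons, wdl_map, wdl_congr h1 fun m hm _ =>
      ih fun x hx => hl x (hm.subset hx), wdl_weight_sum, labelledLists, Finset.sum_image,
      Finset.sum_product]
    · simp only [List.map_cons, Alt_cons, wdl_sum]
    · rintro ⟨x, σ⟩ - ⟨y, τ⟩ - h
      simpa using h

end

section

variable {n : ℕ} {D : Type*}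

/-- The first coordinate in which a vector is positive. -/
noncomputable def posLabel (v : Fin n → ℝ) : Option (Fin n) :=
  firstLabel (List.finRange n) fun k => 0 < v k

/-- The cochain detecting the simplices around the origin. -/
noncomputable def degForm (l : List (Fin n → ℝ)) : ℤ :=
  labelForm (List.finRange n) (l.map posLabel)

lemma dl_degForm (l : List (Fin n → ℝ)) : dl degForm l = 0 := by
  have := dl_labelForm n (l.map posLabel)
  rwa [dl, wdl_map] at this

lemma norm_le_of_surround {l : List (Fin n → ℝ)} (h1 : ∀ k, ∃ y ∈ l, 0 < y k)
    (h2 : ∃ y ∈ l, ∀ k, y k ≤ 0) {v : Fin n → ℝ} {r : ℝ} (h : ∀ y ∈ l, dist y v ≤ r) :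
    ‖v‖ ≤ r := by
  obtain ⟨y₀, hy₀, h2⟩ := h2
  have hr : 0 ≤ r := dist_nonneg.trans (h y₀ hy₀)
  refine (pi_norm_le_iff_of_nonneg hr).2 fun k => ?_
  obtain ⟨y, hy, hyk⟩ := h1 k
  have h3 := (dist_pi_le_iff hr).1 (h y hy) k
  have h4 := (dist_pi_le_iff hr).1 (h y₀ hy₀) k
  have h5 := h2 k
  rw [Real.dist_eq, abs_le] at h3 h4
  rw [Real.norm_eq_abs, abs_le]
  constructor <;> linarith

lemma degForm_eq_zero {l : List (Fin n → ℝ)} {v : Fin n → ℝ} {r : ℝ}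
    (h : ∀ y ∈ l, dist y v ≤ r) (hv : r < ‖v‖) : degForm l = 0 := by
  by_contra h0
  obtain ⟨-, h1, h2⟩ := labelForm_rainbow (p := fun (v : Fin n → ℝ) k => 0 < v k) h0
  exact hv.not_ge (norm_le_of_surround (fun k => h1 k (List.mem_finRange k))
    (h2.imp fun y hy => ⟨hy.1, fun k => not_lt.1 (hy.2 k (List.mem_finRange k))⟩) h)

/-- Homotopy invariance of the degree. -/
lemma cube_degForm_homotopy [DecidableEq D] {N : ℤ} (hN : 0 ≤ N) {z₀ : D → ℤ} (hz : ∀ d, |z₀ d| ≤ N)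
    {ds : List D} (hds : ds.Nodup) {a b v : (D → ℤ) → Fin n → ℝ} {r η : ℝ}
    (ha : ∀ z, Adm N z₀ ds [z] → dist (a z) (v z) ≤ r)
    (hb : ∀ z, Adm N z₀ ds [z] → dist (b z) (v z) ≤ r)
    (hv : ∀ z w, Adm N z₀ ds [z, w] → dist (v z) (v w) ≤ η)
    (hbd : ∀ z, Adm N z₀ ds [z] → OnBdry N ds [z] → r + η < ‖v z‖) :
    cube N ds (fun l => degForm (l.map a)) [z₀] = cube N ds (fun l => degForm (l.map b)) [z₀] := by
  refine cube_homotopy hN hz hds a b degForm (fun _ _ _ _ _ _ _ => dl_degForm _) ?_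
  rintro l hl ⟨d, hd, hld⟩ u x w hlu -
  have hx : x ∈ l := by simp [hlu]
  have hx' : Adm N z₀ ds [x] := hl.sublist (by simpa using hx)
  refine degForm_eq_zero (v := v x) (r := r + η) (fun y hy => ?_)
    (hbd x hx' ⟨d, hd, by simpa using hld x hx⟩)
  obtain ⟨z, hz, hy⟩ := mem_prism_list hlu hy
  have h1 : Adm N z₀ ds [z] := hl.sublist (by simpa using hz)
  have h2 := hv z x (hl.sublist (by simp [hz, hx]))
  rcases hy with rfl | rfl
  · exact (dist_triangle _ (v z) _).trans (add_le_add (ha z h1) h2)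
  · exact (dist_triangle _ (v z) _).trans (add_le_add (hb z h1) h2)

/-- The degree only depends on the map near its zeros. -/
lemma cube_degForm_local [DecidableEq D] {N : ℤ} {z₀ : D → ℤ} (hz : ∀ d, |z₀ d| ≤ N)
    {ds : List D} {a b : (D → ℤ) → Fin n → ℝ} {η : ℝ}
    (ha : ∀ z w, Adm N z₀ ds [z, w] → dist (a z) (a w) ≤ η)
    (hb : ∀ z w, Adm N z₀ ds [z, w] → dist (b z) (b w) ≤ η)
    (hab : ∀ z, Adm N z₀ ds [z] → a z ≠ b z → η < ‖a z‖ ∧ η < ‖b z‖) :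
    cube N ds (fun l => degForm (l.map a)) [z₀] = cube N ds (fun l => degForm (l.map b)) [z₀] := by
  refine cube_congr (adm_singleton hz []) fun l hl _ => ?_
  by_cases h : ∀ z ∈ l, a z = b z
  · rw [List.map_congr_left h]
  · push Not at h
    obtain ⟨x, hx, hne⟩ := h
    obtain ⟨h1, h2⟩ := hab x (hl.sublist (by simpa using hx)) hne
    have key : ∀ f : (D → ℤ) → Fin n → ℝ, (∀ z w, Adm N z₀ ds [z, w] → dist (f z) (f w) ≤ η) →
        ∀ y ∈ l.map f, dist y (f x) ≤ η := by
      intro f hf y hy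
      obtain ⟨z, hz, rfl⟩ := List.mem_map.1 hy
      exact hf z x (hl.sublist (by simp [hz, hx]))
    rw [degForm_eq_zero (key a ha) h1, degForm_eq_zero (key b hb) h2]

/-- The point of the cube with centre `x₀` and radius `c` with lattice coordinates `z ∘ ι`. -/
noncomputable def latPt (x₀ : Fin n → ℝ) (c : ℝ) (N : ℤ) (ι : Fin n → D) (z : D → ℤ) : Fin n → ℝ :=
  fun k => x₀ k + c / N * z (ι k)

/-- The list of directions used by `latPt`. -/
def dirs (ι : Fin n → D) : List D := (List.finRange n).map ι

lemma dirs_nodup {ι : Fin n → D} (hι : ι.Injective) : (dirs ι).Nodup :=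
  (List.nodup_finRange n).map hι

lemma length_dirs (ι : Fin n → D) : (dirs ι).length = n := by simp [dirs]

lemma mem_dirs {ι : Fin n → D} {d : D} : d ∈ dirs ι ↔ ∃ k, ι k = d := by simp [dirs]

section latPt
variable {x₀ : Fin n → ℝ} {c : ℝ} {N : ℤ} {ι : Fin n → D} {z₀ : D → ℤ} {ds : List D}

lemma latPt_mem (hc : 0 ≤ c) (hN : 1 ≤ N) {z : D → ℤ} (hz : Adm N z₀ ds [z]) :
    dist (latPt x₀ c N ι z) x₀ ≤ c := by
  have hN' : (0 : ℝ) < N := by exact_mod_cast hN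
  refine (dist_pi_le_iff hc).2 fun k => ?_
  have h1 : |(z (ι k) : ℝ)| ≤ N := by exact_mod_cast hz.bound z (by simp) (ι k)
  rw [Real.dist_eq, latPt, add_sub_cancel_left, abs_mul, abs_of_nonneg (by positivity)]
  calc c / N * |(z (ι k) : ℝ)| ≤ c / N * N := by gcongr
    _ = c := by field_simp

lemma latPt_close (hc : 0 ≤ c) (hN : 1 ≤ N) {z w : D → ℤ} (hz : Adm N z₀ ds [z, w]) :
    dist (latPt x₀ c N ι z) (latPt x₀ c N ι w) ≤ c / N := by
  have hN' : (0 : ℝ) < N := by exact_mod_cast hN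
  have hcN : 0 ≤ c / N := by positivity
  refine (dist_pi_le_iff hcN).2 fun k => ?_
  have h1 : |(z (ι k) : ℝ) - w (ι k)| ≤ 1 := by
    exact_mod_cast hz.close z (by simp) w (by simp) (ι k)
  rw [Real.dist_eq, latPt, latPt, add_sub_add_left_eq_sub, ← mul_sub, abs_mul, abs_of_nonneg hcN]
  exact mul_le_of_le_one_right hcN h1

lemma latPt_bdry (hc : 0 ≤ c) (hN : 1 ≤ N) {z : D → ℤ} {k : Fin n} (hz : |z (ι k)| = N) :
    c ≤ dist (latPt x₀ c N ι z) x₀ := by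
  have hN' : (0 : ℝ) < N := by exact_mod_cast hN
  refine le_trans ?_ (dist_le_pi_dist _ _ k)
  have h1 : |(z (ι k) : ℝ)| = N := by exact_mod_cast hz
  rw [Real.dist_eq, latPt, add_sub_cancel_left, abs_mul, abs_of_nonneg (by positivity), h1]
  apply le_of_eq; field_simp

lemma latPt_update [DecidableEq D] {d : D} (h : ∀ k, ι k ≠ d) (z : D → ℤ) (t : ℤ) :
    latPt x₀ c N ι (Function.update z d t) = latPt x₀ c N ι z := by
  funext k; simp [latPt, h k]

lemma cube_degForm_eval [DecidableEq D] (hc : 0 < c) (hN : 1 ≤ N) (hz : ∀ d, |z₀ d| ≤ N)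
    (hι : ι.Injective)
    {q : Fin n → ℝ} (hq : dist q x₀ < c) :
    cube N (dirs ι) (fun l => degForm (l.map fun z => latPt x₀ c N ι z - q)) [z₀] = (-1) ^ n := by
  have hN' : (0 : ℝ) < N := by exact_mod_cast hN
  have h := cube_labelForm hz (L := List.finRange n) (ι := ι) (List.nodup_finRange n)
    (fun i _ j _ h => hι h) (θ := fun k => ⌊N / c * (q k - x₀ k)⌋) fun k _ => by
      have h1 := (dist_pi_lt_iff hc).1 hq k
      rw [Real.dist_eq, abs_lt] at h1
      rw [Int.le_floor, Int.floor_lt]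
      have hNc : 0 < N / c := by positivity
      have h2 : N / c * c = N := by field_simp
      push_cast
      constructor
      · nlinarith
      · nlinarith
  rw [List.length_finRange] at h
  rw [← h, dirs]
  congr 1
  funext l
  rw [degForm, List.map_map]
  congr 1
  refine List.map_congr_left fun z _ => firstLabel_congr fun k _ => ?_
  rw [Int.floor_lt]
  simp only [Pi.sub_apply, latPt]
  rw [show x₀ k + c / N * z (ι k) - q k = c / N * (z (ι k) - N / c * (q k - x₀ k)) by
    field_simp; ring, mul_pos_iff_of_pos_left (by positivity), sub_pos]

end latPt

lemma slant_map [DecidableEq D] {N : ℤ} {d : D} {π : (D → ℤ) → D → ℤ}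
    (h : ∀ z t, π (Function.update z d t) = Function.update (π z) d t)
    (Φ : List (D → ℤ) → ℤ) (l : List (D → ℤ)) :
    slant N d (fun m => Φ (m.map π)) l = slant N d Φ (l.map π) := by
  refine Finset.sum_congr rfl fun t _ => ?_
  induction l generalizing Φ with
  | nil => rfl
  | cons z l ih => simp only [prism, List.map_cons, List.map_map, h, ← ih, Function.comp_def]

lemma cube_map [DecidableEq D] {N : ℤ} {ds : List D} {π : (D → ℤ) → D → ℤ}
    (h : ∀ d ∈ ds, ∀ z t, π (Function.update z d t) = Function.update (π z) d t)
    (Φ : List (D → ℤ) → ℤ) (l : List (D → ℤ)) :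
    cube N ds (fun m => Φ (m.map π)) l = cube N ds Φ (l.map π) := by
  induction ds generalizing Φ with
  | nil => rfl
  | cons d ds ih =>
    simp only [cube, funext (slant_map (h d (by simp)) Φ)]
    exact ih (fun e he => h e (by simp [he])) _

end

section

variable {n : ℕ}

/-- The integral of a cochain over the cube with centre `x₀` and radius `c`. -/
noncomputable def integ (x₀ : Fin n → ℝ) (c : ℝ) (N : ℤ) (φ : List (Fin n → ℝ) → ℤ) : ℤ :=
  cube N (dirs (Sum.inl : Fin n → Fin n ⊕ Fin n)) (fun l => φ (l.map (latPt x₀ c N Sum.inl))) [0]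

/-- The cup product behind the duality between the two factors of the double cube. -/
lemma integ_comp_aux {x₀ q : Fin n → ℝ} {c η ρ : ℝ} {N : ℤ} (hc : 0 < c) (hN : 1 ≤ N)
    (hcN : c / N ≤ η) (hρc : ρ ≤ c) (hηρ : 6 * η < ρ) (hq : dist q x₀ ≤ ρ / 2) {ε : ℤ}
    (hε : ∀ (Φ : List (Fin n ⊕ Fin n → ℤ) → ℤ) l, cube N (dirs Sum.inl ++ dirs Sum.inr) Φ l =
      ε * cube N (dirs Sum.inr ++ dirs Sum.inl) Φ l)
    {φ : List (Fin n → ℝ) → ℤ} (hφ : IsAlt φ) (hφS : ∀ l, φ l ≠ 0 → ∀ y ∈ l, dist y x₀ ≤ ρ / 2)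
    (hφd : ∀ l : List (Fin n → ℝ), l.length = n + 2 → (∀ y ∈ l, dist y x₀ ≤ c + 2 * η) →
      (∀ y ∈ l, ∀ y' ∈ l, dist y y' ≤ 3 * η) → dl φ l = 0)
    {f : (Fin n → ℝ) → Fin n → ℝ}
    (hf : ∀ x y, dist x x₀ ≤ c → dist y x₀ ≤ c → dist x y ≤ c / N → dist (f x) (f y) ≤ η)
    (hbd : ∀ x, dist x x₀ = c → ρ ≤ dist (f x) x₀)
    (hloc : ∀ x, dist x x₀ ≤ c → f x ≠ x → η < dist (f x) q ∧ η < dist x q) :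
    cube N (dirs (Sum.inl : Fin n → Fin n ⊕ Fin n))
        (fun l => degForm (l.map fun z => q - latPt x₀ c N Sum.inl z)) [0] *
      cube N (dirs (Sum.inr : Fin n → Fin n ⊕ Fin n))
        (fun l => φ (l.map (latPt x₀ c N Sum.inr))) [0] =
    ε * ((-1) ^ n * integ x₀ c N fun l => φ (l.map f)) := by
  set X : (Fin n ⊕ Fin n → ℤ) → Fin n → ℝ := latPt x₀ c N Sum.inl with hX
  set Y : (Fin n ⊕ Fin n → ℤ) → Fin n → ℝ := latPt x₀ c N Sum.inr with hY
  set xs : List (Fin n ⊕ Fin n) := dirs Sum.inl with hxs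
  set ys : List (Fin n ⊕ Fin n) := dirs Sum.inr with hys
  have hN0 : 0 ≤ N := by omega
  have hη : 0 ≤ η := le_trans (div_nonneg hc.le (by exact_mod_cast hN0)) hcN
  have hz0 : ∀ d : Fin n ⊕ Fin n, |(0 : Fin n ⊕ Fin n → ℤ) d| ≤ N := fun d => by simpa using hN0
  have hxsn : xs.Nodup := dirs_nodup Sum.inl_injective
  have hysn : ys.Nodup := dirs_nodup Sum.inr_injective
  have hdisj : (xs ++ ys).Nodup := by
    refine List.nodup_append.2 ⟨hxsn, hysn, ?_⟩
    rintro d hd e he rfl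
    obtain ⟨i, rfl⟩ := mem_dirs.1 hd
    obtain ⟨j, hj⟩ := mem_dirs.1 he
    cases hj
  have hlx : xs.length = n := length_dirs _
  have hly : ys.length = n := length_dirs _
  have hXm : ∀ {z₀ ds z}, Adm N z₀ ds [z] → dist (X z) x₀ ≤ c := fun h => latPt_mem hc.le hN h
  have hYm : ∀ {z₀ ds z}, Adm N z₀ ds [z] → dist (Y z) x₀ ≤ c := fun h => latPt_mem hc.le hN h
  have hYY : ∀ {z₀ ds z w}, Adm N z₀ ds [z, w] → dist (Y z) (Y w) ≤ η :=
    fun h => (latPt_close hc.le hN h).trans hcN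
  have hXX : ∀ {z₀ ds z w}, Adm N z₀ ds [z, w] → dist (X z) (X w) ≤ η :=
    fun h => (latPt_close hc.le hN h).trans hcN
  have hff : ∀ {z₀ ds z w}, Adm N z₀ ds [z, w] → dist (f (X z)) (f (X w)) ≤ η := fun h =>
    hf _ _ (hXm (h.sublist (by simp))) (hXm (h.sublist (by simp))) (latPt_close hc.le hN h)
  have hXd : ∀ d ∈ ys, ∀ z t, X (Function.update z d t) = X z := fun d hd z t => by
    obtain ⟨j, rfl⟩ := mem_dirs.1 hd
    exact latPt_update (by simp) z t
  have hYd : ∀ d ∈ xs, ∀ z t, Y (Function.update z d t) = Y z := fun d hd z t => by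
    obtain ⟨j, rfl⟩ := mem_dirs.1 hd
    exact latPt_update (by simp) z t
  have hXc : ∀ {z₀ z}, Adm N z₀ ys [z] → X z = X z₀ := fun {z₀ z} h => by
    funext k
    simp only [hX, latPt]
    rw [h.eq_of_notMem z (by simp) (Sum.inl k) fun hk => by
      obtain ⟨j, hj⟩ := mem_dirs.1 hk; cases hj]
  have hYc : ∀ {z₀ z}, Adm N z₀ xs [z] → Y z = Y z₀ := fun {z₀ z} h => by
    funext k
    simp only [hY, latPt]
    rw [h.eq_of_notMem z (by simp) (Sum.inr k) fun hk => by
      obtain ⟨j, hj⟩ := mem_dirs.1 hk; cases hj]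
  set α : List (Fin n ⊕ Fin n → ℤ) → ℤ := fun l => degForm (l.map fun z => Y z - f (X z)) with hα
  -- the homotopy between the two factors
  have hhom : cube N (xs ++ ys) (cup n α fun l => φ (l.map Y)) [0] =
      cube N (xs ++ ys) (cup n α fun l => φ (l.map fun z => f (X z))) [0] := by
    have hlen : (xs ++ ys).length = n + n := by simp [hlx, hly]
    have hcupmap : ∀ W : (Fin n ⊕ Fin n → ℤ) → Fin n → ℝ,
        (cup n α fun l => φ (l.map W)) = fun l => cup n
          (fun m : List ((Fin n → ℝ) × (Fin n → ℝ)) => degForm (m.map Prod.fst))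
          (fun m => φ (m.map Prod.snd)) (l.map fun z => (Y z - f (X z), W z)) := by
      intro W
      funext l
      simp [cup, hα, ← List.map_take, ← List.map_drop, Function.comp_def]
    rw [hcupmap Y, hcupmap fun z => f (X z)]
    set b : (Fin n ⊕ Fin n → ℤ) → (Fin n → ℝ) × (Fin n → ℝ) := fun z => (Y z - f (X z), Y z)
    set b' : (Fin n ⊕ Fin n → ℤ) → (Fin n → ℝ) × (Fin n → ℝ) := fun z => (Y z - f (X z), f (X z))
    -- on lists where the first factor does not vanish
    have key : ∀ l, Adm N 0 (xs ++ ys) l → ∀ m : List ((Fin n → ℝ) × (Fin n → ℝ)),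
        (∀ p ∈ m, ∃ z ∈ l, p = b z ∨ p = b' z) → ∀ k, degForm ((m.take k).map Prod.fst) ≠ 0 →
        ∀ z ∈ l, dist (Y z) (f (X z)) ≤ 2 * η := by
      intro l hl m hm k h0 z hz
      by_contra! hlt
      rw [dist_eq_norm] at hlt
      refine h0 (degForm_eq_zero (fun y hy => ?_) hlt)
      obtain ⟨p, hp, rfl⟩ := List.mem_map.1 hy
      obtain ⟨w, hw, hpw⟩ := hm p (List.mem_of_mem_take hp)
      have : p.1 = Y w - f (X w) := by rcases hpw with rfl | rfl <;> rfl
      rw [this]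
      have hwz := hl.sublist (m := [w, z]) (by simp [hw, hz])
      exact (dist_sub_sub_le _ _ _ _).trans (by linarith [hYY hwz, hff hwz])
    refine cube_homotopy hN0 hz0 hdisj b b' _ ?_ ?_
    · intro l hl u x w hlu hll
      have hm : ∀ p ∈ u.map b ++ b x :: b' x :: w.map b', ∃ z ∈ l, p = b z ∨ p = b' z :=
        fun p hp => mem_prism_list hlu hp
      have hml : (u.map b ++ b x :: b' x :: w.map b').length = n + n + 2 := by
        rw [hlen] at hll; simp [hlu] at hll ⊢; omega
      set m := u.map b ++ b x :: b' x :: w.map b'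
      rw [dl_cup _ _ _ _ (by omega)]
      have h1 : dl (fun m : List ((Fin n → ℝ) × (Fin n → ℝ)) => degForm (m.map Prod.fst))
          (m.take (n + 2)) = 0 := by
        have := dl_degForm ((m.take (n + 2)).map Prod.fst)
        rwa [dl, wdl_map] at this
      rw [h1, zero_mul, zero_add]
      by_cases h0 : degForm ((m.take (n + 1)).map Prod.fst) = 0
      · rw [h0]; ring
      · have hk := key l hl m hm _ h0
        have h2 : dl (fun m : List ((Fin n → ℝ) × (Fin n → ℝ)) => φ (m.map Prod.snd))
            (m.drop n) = 0 := by
          have h3 : ∀ y ∈ (m.drop n).map Prod.snd, ∃ z ∈ l, y = Y z ∨ y = f (X z) := by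
            intro y hy
            obtain ⟨p, hp, rfl⟩ := List.mem_map.1 hy
            obtain ⟨z, hz, rfl | rfl⟩ := hm p (List.mem_of_mem_drop hp)
            · exact ⟨z, hz, Or.inl rfl⟩
            · exact ⟨z, hz, Or.inr rfl⟩
          have := hφd ((m.drop n).map Prod.snd) (by simp [hml]; omega) ?_ ?_
          · rwa [dl, wdl_map] at this
          · intro y hy
            obtain ⟨z, hz, h4⟩ := h3 y hy
            have h5 := hYm (hl.sublist (m := [z]) (by simpa using hz))
            have h6 := hk z hz
            rw [dist_comm] at h6
            rcases h4 with rfl | rfl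
            · linarith
            · linarith [dist_triangle (f (X z)) (Y z) x₀]
          · intro y hy y' hy'
            obtain ⟨z, hz, h4⟩ := h3 y hy
            obtain ⟨z', hz', h4'⟩ := h3 y' hy'
            have hzz := hl.sublist (m := [z, z']) (by simp [hz, hz'])
            have h6 := hk z hz
            have h6' := hk z' hz'
            have h7 := hYY hzz
            have h8 := hff hzz
            rcases h4 with rfl | rfl <;> rcases h4' with rfl | rfl
            · linarith
            · linarith [dist_triangle (Y z) (Y z') (f (X z'))]
            · rw [dist_comm] at h6
              linarith [dist_triangle (f (X z)) (Y z) (Y z')]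
            · linarith
        rw [h2]; ring
    · rintro l hl ⟨d, hd, hld⟩ u x w hlu hll
      have hm : ∀ p ∈ u.map b ++ b x :: b' x :: w.map b', ∃ z ∈ l, p = b z ∨ p = b' z :=
        fun p hp => mem_prism_list hlu hp
      have hml : (u.map b ++ b x :: b' x :: w.map b').length = n + n + 1 := by
        rw [hlen] at hll; simp [hlu] at hll ⊢; omega
      set m := u.map b ++ b x :: b' x :: w.map b'
      by_contra h0
      have h1 := key l hl m hm _ (left_ne_zero_of_mul h0)
      have h2 := hφS _ (right_ne_zero_of_mul h0)
      obtain ⟨p, hp⟩ := List.exists_mem_of_length_pos (l := m.drop n) (by simp [hml])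
      have h3 := h2 p.2 (List.mem_map.2 ⟨p, hp, rfl⟩)
      obtain ⟨z, hz, hpz⟩ := hm p (List.mem_of_mem_drop hp)
      have h4 := h1 z hz
      have h5 : dist (Y z) x₀ ≤ ρ / 2 + 2 * η ∧ dist (f (X z)) x₀ ≤ ρ / 2 + 2 * η := by
        have h4' := h4
        rw [dist_comm] at h4'
        rcases hpz with rfl | rfl
        · have h3 : dist (Y z) x₀ ≤ ρ / 2 := h3
          exact ⟨by linarith, by linarith [dist_triangle (f (X z)) (Y z) x₀]⟩
        · have h3 : dist (f (X z)) x₀ ≤ ρ / 2 := h3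
          exact ⟨by linarith [dist_triangle (Y z) (f (X z)) x₀], by linarith⟩
      have hz1 : Adm N 0 (xs ++ ys) [z] := hl.sublist (by simpa using hz)
      rcases List.mem_append.1 hd with hd | hd
      · obtain ⟨k, rfl⟩ := mem_dirs.1 hd
        have := hbd (X z) (le_antisymm (hXm hz1) (latPt_bdry hc.le hN (hld z hz)))
        linarith
      · obtain ⟨k, rfl⟩ := mem_dirs.1 hd
        have : c ≤ dist (Y z) x₀ := latPt_bdry hc.le hN (hld z hz)
        linarith
  -- evaluation of the left-hand side
  have hleft : cube N (xs ++ ys) (cup n α fun l => φ (l.map Y)) [0] =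
      cube N xs (fun l => degForm (l.map fun z => q - X z)) [0] *
        cube N ys (fun l => φ (l.map Y)) [0] := by
    have h1 : cube N xs (cup n α fun l => φ (l.map Y)) =
        fun l => cube N xs α (l.take 1) * φ (l.map Y) := by
      funext l
      have := cube_cup (N := N) (ds := xs) (β := fun l => φ (l.map Y)) (fun d hd t l => by
        simp only [List.map_map, Function.comp_def, hYd d hd]) (fun d hd s t u x w => by
        simp only [List.map_append, List.map_cons, hYd d hd]
        have := hφ (u.map Y) (Y x) (Y x) (w.map Y)
        omega) α l
      rwa [hlx] at this
    rw [cube_append, h1, ← cube_const_mul]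
    refine cube_congr (adm_singleton hz0 []) fun l hl hll => ?_
    by_cases h0 : φ (l.map Y) = 0
    · rw [h0]; ring
    · congr 1
      rcases l with - | ⟨z, l⟩
      · simp at hll
      have hz1 : Adm N 0 ys [z] := hl.sublist (by simp)
      have hz : ∀ d, |z d| ≤ N := hz1.bound z (by simp)
      have hYz : dist (Y z) x₀ ≤ ρ / 2 := hφS _ h0 _ (by simp)
      simp only [List.take_succ_cons, List.take_zero]
      trans cube N xs (fun l => degForm (l.map fun z => q - f (X z))) [z]
      · refine cube_degForm_homotopy hN0 hz hxsn (v := fun z => x₀ - f (X z)) (r := ρ / 2)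
          (η := η) ?_ ?_ ?_ ?_
        · intro w hw
          rw [dist_sub_right, hYc hw]; exact hYz
        · intro w hw
          rw [dist_sub_right]; exact hq
        · intro w w' hw
          rw [dist_sub_left]; exact hff hw
        · rintro w hw ⟨d, hd, hdw⟩
          obtain ⟨k, rfl⟩ := mem_dirs.1 hd
          have := hbd (X w) (le_antisymm (hXm hw) (latPt_bdry hc.le hN (hdw w (by simp))))
          rw [← dist_eq_norm, dist_comm]
          linarith
      trans cube N xs (fun l => degForm (l.map fun z => q - X z)) [z]
      · refine cube_degForm_local hz (η := η) ?_ ?_ ?_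
        · intro w w' hw
          rw [dist_sub_left]; exact hff hw
        · intro w w' hw
          rw [dist_sub_left]; exact hXX hw
        · intro w hw hne
          rw [← dist_eq_norm, ← dist_eq_norm, dist_comm, dist_comm q]
          exact hloc _ (hXm hw) fun h => hne (by rw [h])
      · set π : (Fin n ⊕ Fin n → ℤ) → Fin n ⊕ Fin n → ℤ :=
          fun z => Sum.elim (fun k => z (Sum.inl k)) fun _ => 0 with hπ
        have h3 := cube_map (N := N) (ds := xs) (π := π) (fun d hd z t => by
          obtain ⟨k, rfl⟩ := mem_dirs.1 hd
          funext e
          rcases e with e | e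
          · by_cases hek : e = k
            · subst hek; simp [hπ]
            · simp [hπ, hek]
          · simp [hπ]) (fun l => degForm (l.map fun z => q - X z)) [z]
        have h4 : ∀ z, X (π z) = X z := fun z => rfl
        simp only [List.map_map, Function.comp_def, h4, List.map_cons, List.map_nil] at h3
        rw [h3]
        congr 2
        funext d
        rcases d with k | k
        · exact hz1.eq_of_notMem z (by simp) _ fun hk => by
            obtain ⟨j, hj⟩ := mem_dirs.1 hk; cases hj
        · rfl
  -- evaluation of the right-hand side
  have hright : cube N (ys ++ xs) (cup n α fun l => φ (l.map fun z => f (X z))) [0] =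
      (-1) ^ n * integ x₀ c N fun l => φ (l.map f) := by
    have h1 : cube N ys (cup n α fun l => φ (l.map fun z => f (X z))) =
        fun l => cube N ys α (l.take 1) * φ (l.map fun z => f (X z)) := by
      funext l
      have := cube_cup (N := N) (ds := ys) (β := fun l => φ (l.map fun z => f (X z)))
        (fun d hd t l => by
        simp only [List.map_map, Function.comp_def, hXd d hd]) (fun d hd s t u x w => by
        simp only [List.map_append, List.map_cons, hXd d hd]
        have := hφ (u.map fun z => f (X z)) (f (X x)) (f (X x)) (w.map fun z => f (X z))
        omega) α l
      rwa [hly] at this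
    rw [cube_append, h1, integ, ← cube_const_mul]
    refine cube_congr (adm_singleton hz0 []) fun l hl hll => ?_
    rw [List.map_map]
    by_cases h0 : φ (l.map fun z => f (X z)) = 0
    · simp only [Function.comp_def, ← hX, h0, mul_zero]
    · congr 1
      rcases l with - | ⟨z, l⟩
      · simp at hll
      have hz1 : Adm N 0 xs [z] := hl.sublist (by simp)
      have hz : ∀ d, |z d| ≤ N := hz1.bound z (by simp)
      have hYz : dist (f (X z)) x₀ ≤ ρ / 2 := hφS _ h0 _ (by simp)
      simp only [List.take_succ_cons, List.take_zero]
      rw [← cube_degForm_eval hc hN hz Sum.inr_injective (q := f (X z)) (x₀ := x₀) (by linarith)]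
      refine cube_congr (adm_singleton hz []) fun m hm _ => ?_
      simp only [hα]
      congr 1
      refine List.map_congr_left fun w hw => ?_
      rw [hXc (hm.sublist (m := [w]) (by simpa using hw))]
  rw [← hleft, hhom, hε, hright]

/-- Replacing the identity by a map close to it on the zeros of a cochain does not affect the
integral of the cochain, as long as the two maps agree near one point. -/
lemma integ_comp {x₀ q : Fin n → ℝ} {c η ρ : ℝ} {N : ℤ} (hc : 0 < c) (hN : 1 ≤ N)
    (hcN : c / N ≤ η) (hρc : ρ ≤ c) (hηρ : 6 * η < ρ) (hq : dist q x₀ ≤ ρ / 2)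
    {φ : List (Fin n → ℝ) → ℤ} (hφ : IsAlt φ) (hφS : ∀ l, φ l ≠ 0 → ∀ y ∈ l, dist y x₀ ≤ ρ / 2)
    (hφd : ∀ l : List (Fin n → ℝ), l.length = n + 2 → (∀ y ∈ l, dist y x₀ ≤ c + 2 * η) →
      (∀ y ∈ l, ∀ y' ∈ l, dist y y' ≤ 3 * η) → dl φ l = 0)
    {f : (Fin n → ℝ) → Fin n → ℝ}
    (hf : ∀ x y, dist x x₀ ≤ c → dist y x₀ ≤ c → dist x y ≤ c / N → dist (f x) (f y) ≤ η)
    (hbd : ∀ x, dist x x₀ = c → ρ ≤ dist (f x) x₀)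
    (hloc : ∀ x, dist x x₀ ≤ c → f x ≠ x → η < dist (f x) q ∧ η < dist x q) :
    (integ x₀ c N fun l => φ (l.map f)) = integ x₀ c N φ := by
  have hdisj : (dirs (Sum.inl : Fin n → Fin n ⊕ Fin n) ++ dirs Sum.inr).Nodup := by
    refine List.nodup_append.2 ⟨dirs_nodup Sum.inl_injective, dirs_nodup Sum.inr_injective, ?_⟩
    rintro d hd e he rfl
    obtain ⟨i, rfl⟩ := mem_dirs.1 hd
    obtain ⟨j, hj⟩ := mem_dirs.1 he
    cases hj
  obtain ⟨ε, hε, hεΦ⟩ := cube_perm N List.perm_append_comm hdisj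
  have h1 := integ_comp_aux hc hN hcN hρc hηρ hq hεΦ hφ hφS hφd hf hbd hloc
  have h2 := integ_comp_aux hc hN hcN hρc hηρ hq hεΦ hφ hφS hφd (f := fun x => x)
    (fun x y _ _ h => h.trans hcN) (fun x h => by linarith) (fun x _ h => absurd rfl h)
  simp only [List.map_id'] at h2
  rw [h1] at h2
  have hn : ((-1 : ℤ) ^ n) * (-1) ^ n = 1 := by rw [← mul_pow]; simp
  calc _ = (ε * ε) * ((-1) ^ n * (-1) ^ n) * (integ x₀ c N fun l => φ (l.map f)) := by
        rw [hε, hn]; ring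
    _ = ε * (-1) ^ n * (ε * ((-1) ^ n * integ x₀ c N fun l => φ (l.map f))) := by ring
    _ = ε * (-1) ^ n * (ε * ((-1) ^ n * integ x₀ c N φ)) := by rw [h2]
    _ = (ε * ε) * ((-1) ^ n * (-1) ^ n) * integ x₀ c N φ := by ring
    _ = _ := by rw [hε, hn]; ring

end

section

lemma dvd_card_of_free {α : Type*} {S : Finset α} {γ : α → α} {p : ℕ} (hp : p.Prime)
    (hγ : ∀ x ∈ S, γ x ∈ S) (hγp : ∀ x ∈ S, γ^[p] x = x) (hfree : ∀ x ∈ S, γ x ≠ x) :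
    p ∣ S.card := by
  classical
  have := Fact.mk hp
  let f : S → S := fun x => ⟨γ x, hγ x x.2⟩
  have hf : ∀ (k : ℕ) (x : S), ((f^[k] x : S) : α) = γ^[k] x := by
    intro k
    induction k with
    | zero => intro x; rfl
    | succ k ih => intro x; rw [Function.iterate_succ_apply, ih, Function.iterate_succ_apply]
  have hfp : ∀ x, f^[p] x = x := fun x => Subtype.ext ((hf p x).trans (hγp x x.2))
  let e : Function.End S := f
  have he : e ^ p ^ 1 = 1 := by
    rw [pow_one]
    exact funext hfp
  have h := Equiv.Perm.card_fixedPoints_modEq he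
  have h0 : Fintype.card (Function.fixedPoints e) = 0 := by
    rw [Fintype.card_eq_zero_iff]
    exact ⟨fun x => hfree x.1 x.1.2 (congrArg Subtype.val x.2)⟩
  rw [h0, Fintype.card_coe] at h
  exact (Nat.modEq_zero_iff_dvd).1 h

lemma dvd_sum_of_free {α : Type*} {S : Finset α} {γ : α → α} {p : ℕ} (hp : p.Prime)
    (hγ : ∀ x ∈ S, γ x ∈ S) (hγp : ∀ x ∈ S, γ^[p] x = x) (hfree : ∀ x ∈ S, γ x ≠ x)
    {m : α → ℤ} (hm : ∀ x ∈ S, m (γ x) = m x) : (p : ℤ) ∣ ∑ x ∈ S, m x := by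
  classical
  have h := Finset.sum_comp (s := S) (fun v : ℤ => v) m
  rw [h]
  refine Finset.dvd_sum fun v _ => ?_
  rw [nsmul_eq_mul]
  refine Dvd.dvd.mul_right (Int.natCast_dvd_natCast.2 (dvd_card_of_free hp (γ := γ) ?_ ?_ ?_)) _
  · intro x hx
    rw [Finset.mem_filter] at hx ⊢
    exact ⟨hγ x hx.1, (hm x hx.1).trans hx.2⟩
  · exact fun x hx => hγp x (Finset.mem_filter.1 hx).1
  · exact fun x hx => hfree x (Finset.mem_filter.1 hx).1

lemma Alt_map_congr {A B : Type*} {σ : List B} {f g : B → A → ℤ} {l : List A}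
    (h : ∀ s ∈ σ, ∀ x ∈ l, f s x = g s x) : Alt (σ.map f) l = Alt (σ.map g) l := by
  induction σ generalizing l with
  | nil => rfl
  | cons s σ ih =>
    simp only [List.map_cons, Alt_cons]
    exact wdl_congr (h s (by simp)) fun m hm _ =>
      ih fun t ht x hx => h t (by simp [ht]) x (hm.subset hx)

lemma isAlt_map {A B : Type*} {Φ : List B → ℤ} (h : IsAlt Φ) (r : A → B) :
    IsAlt fun l => Φ (l.map r) := fun u x y w => by
  simpa using h (u.map r) (r x) (r y) (w.map r)

variable {n : ℕ}

lemma exists_of_integ_ne_zero {x₀ : Fin n → ℝ} {c τ : ℝ} {N : ℤ} (hc : 0 < c) (hN : 1 ≤ N)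
    (hcN : c / N ≤ τ) {φ : List (Fin n → ℝ) → ℤ} (h : integ x₀ c N φ ≠ 0) :
    ∃ l : List (Fin n ⊕ Fin n → ℤ), φ (l.map (latPt x₀ c N Sum.inl)) ≠ 0 ∧
      (∀ z ∈ l, ∀ d, |z d| ≤ N) ∧ (∀ z ∈ l, dist (latPt x₀ c N Sum.inl z) x₀ ≤ c) ∧
      ∀ z ∈ l, ∀ w ∈ l, dist (latPt x₀ c N Sum.inl z) (latPt x₀ c N Sum.inl w) ≤ τ := by
  by_contra! hcon
  apply h
  have hz0 : ∀ d : Fin n ⊕ Fin n, |(0 : Fin n ⊕ Fin n → ℤ) d| ≤ N := fun d => by simp; omega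
  rw [integ, cube_congr (Φ' := fun _ => 0 * 0) (adm_singleton hz0 []), cube_const_mul, zero_mul]
  intro l hl _
  by_contra h0
  obtain ⟨z, hz, w, hw, hlt⟩ := hcon l h0 hl.bound
    fun z hz => latPt_mem hc.le hN (hl.sublist (m := [z]) (by simpa using hz))
  exact hlt.not_ge ((latPt_close hc.le hN (hl.sublist (m := [z, w]) (by simp [hz, hw]))).trans hcN)

lemma integ_congr {x₀ : Fin n → ℝ} {c : ℝ} {N : ℤ} (hc : 0 < c) (hN : 1 ≤ N)
    {φ φ' : List (Fin n → ℝ) → ℤ} (h : ∀ l, (∀ y ∈ l, dist y x₀ ≤ c) → φ l = φ' l) :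
    integ x₀ c N φ = integ x₀ c N φ' := by
  have hz0 : ∀ d : Fin n ⊕ Fin n, |(0 : Fin n ⊕ Fin n → ℤ) d| ≤ N := fun d => by simp; omega
  refine cube_congr (adm_singleton hz0 []) fun l hl _ => h _ fun y hy => ?_
  obtain ⟨z, hz, rfl⟩ := List.mem_map.1 hy
  exact latPt_mem hc.le hN (hl.sublist (m := [z]) (by simpa using hz))

/-- If the preimage of `q'` under a `G`-invariant map `h` is free, the degree of `h` over `q'` is
divisible by `p`. Here `r` is an equivariant retraction to a small-dimensional set. -/
lemma dvd_degree {x₀ q q' : Fin n → ℝ} {c τ η ρ : ℝ} {N : ℤ} (hc : 0 < c) (hN : 1 ≤ N)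
    (hcN : c / N ≤ τ) (hρc : ρ ≤ c) (hτρ : 6 * τ < ρ) (hq : dist q x₀ ≤ ρ / 2)
    {U V C : Set (Fin n → ℝ)} {G h r : (Fin n → ℝ) → Fin n → ℝ} {p : ℕ} (hp : p.Prime)
    (hcU : ∀ y, dist y x₀ ≤ c → y ∈ U) (hGp : ∀ y ∈ U, G^[p] y = y)
    (hGinj : ∀ y ∈ U, ∀ y' ∈ U, G y = G y' → y = y')
    (hG : ∀ x y, dist x x₀ ≤ c → dist y x₀ ≤ c → dist x y ≤ c / N → dist (G x) (G y) ≤ τ)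
    (hbd : ∀ x, dist x x₀ = c → ρ ≤ dist (G x) x₀)
    (hloc : ∀ x, dist x x₀ ≤ c → G x ≠ x → τ < dist (G x) q ∧ τ < dist x q)
    (hhG : ∀ y ∈ U, h (G y) = h y) (hrU : ∀ y ∈ U, r y ∈ U) (hrG : ∀ y ∈ U, r (G y) = G (r y))
    (hr : ∀ y, dist (r y) y ≤ η)
    (hV : ∀ σ : List (Fin n → ℝ), (∀ s ∈ σ, ∃ y, dist y x₀ ≤ c ∧ s = r y) →
      (∀ s ∈ σ, ∀ s' ∈ σ, dist s s' ≤ τ + 2 * η) → (∀ k, ∃ s ∈ σ, 0 < (h s - q') k) →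
      (∃ s ∈ σ, ∀ k, (h s - q') k ≤ 0) → ∀ s ∈ σ, s ∈ V)
    (hVU : V ⊆ U) (hVfree : ∀ s ∈ V, G s ≠ s)
    (hVC : ∀ s ∈ V, ∀ y, r y = G s → dist y x₀ ≤ ρ / 2 ∧ y ∈ C)
    (hgood : ∀ l : List (Fin n → ℝ), l.length = n + 2 → (∀ y ∈ l, dist y x₀ ≤ c + 2 * τ) →
      (∀ y ∈ l, ∀ y' ∈ l, dist y y' ≤ 3 * τ) → (∃ y ∈ l, y ∈ C) → ¬ (l.map r).Nodup) :
    (p : ℤ) ∣ integ x₀ c N fun l => degForm (l.map fun y => h (r y) - q') := by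
  classical
  set X : (Fin n ⊕ Fin n → ℤ) → Fin n → ℝ := latPt x₀ c N Sum.inl with hX
  have hz0 : ∀ d : Fin n ⊕ Fin n, |(0 : Fin n ⊕ Fin n → ℤ) d| ≤ N := fun d => by simp; omega
  set R : Finset (Fin n → ℝ) :=
    (Fintype.piFinset fun _ : Fin n ⊕ Fin n => Finset.Icc (-N) N).image fun z => r (X z) with hR
  have hRmem : ∀ z : Fin n ⊕ Fin n → ℤ, (∀ d, |z d| ≤ N) → r (X z) ∈ R := fun z hz =>
    Finset.mem_image_of_mem _ (by simpa [Fintype.mem_piFinset, ← abs_le] using hz)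
  set lab : (Fin n → ℝ) → Option (Fin n) := fun s => posLabel (h s - q') with hlab
  set L : List (Option (Fin n)) := (List.finRange n).map some ++ [none] with hL
  set T := labelledLists R lab L with hT
  set m : List (Fin n → ℝ) → ℤ := fun σ => integ x₀ c N fun l => Alt (σ.map ind) (l.map r) with hm
  -- expansion of the degree
  have hexp : (integ x₀ c N fun l => degForm (l.map fun y => h (r y) - q')) = ∑ σ ∈ T, m σ := by
    simp only [hm, integ]
    rw [← cube_sum]
    refine cube_congr (adm_singleton hz0 []) fun l hl _ => ?_
    have h1 := Alt_label_expand R lab L (l := (l.map X).map r) fun x hx => by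
      simp only [List.map_map, List.mem_map, Function.comp_apply] at hx
      obtain ⟨z, hz, rfl⟩ := hx
      exact hRmem z (hl.bound z hz)
    rw [← h1]
    simp only [degForm, labelForm, hL, List.map_append, List.map_map, List.map_cons, List.map_nil]
    rfl
  -- the support of the coefficients
  have hsupp : ∀ σ, m σ ≠ 0 → (∀ s ∈ σ, s ∈ R) ∧ (∀ s ∈ σ, ∃ y, dist y x₀ ≤ c ∧ s = r y) ∧
      ∀ s ∈ σ, ∀ s' ∈ σ, dist s s' ≤ τ + 2 * η := by
    intro σ hσ
    obtain ⟨l, hl, hl1, hl2, hl3⟩ := exists_of_integ_ne_zero hc hN hcN hσ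
    have key : ∀ s ∈ σ, ∃ z ∈ l, s = r (X z) := by
      intro s hs
      obtain ⟨x, hx, hx0⟩ := exists_mem_of_Alt_ne_zero hl (c := ind s) (List.mem_map_of_mem hs)
      simp only [List.map_map, List.mem_map, Function.comp_apply] at hx
      obtain ⟨z, hz, rfl⟩ := hx
      refine ⟨z, hz, ?_⟩
      by_contra hne
      exact hx0 (if_neg fun h => hne h.symm)
    refine ⟨fun s hs => ?_, fun s hs => ?_, fun s hs s' hs' => ?_⟩
    · obtain ⟨z, hz, rfl⟩ := key s hs
      exact hRmem z (hl1 z hz)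
    · obtain ⟨z, hz, rfl⟩ := key s hs
      exact ⟨X z, hl2 z hz, rfl⟩
    · obtain ⟨z, hz, rfl⟩ := key s hs
      obtain ⟨z', hz', rfl⟩ := key s' hs'
      have h1 := hr (X z)
      have h2 := hr (X z')
      rw [dist_comm] at h2
      linarith [hl3 z hz z' hz', dist_triangle4 (r (X z)) (X z) (X z') (r (X z'))]
  have hTV : ∀ σ ∈ T, m σ ≠ 0 → ∀ s ∈ σ, s ∈ V := by
    intro σ hσ hmσ
    obtain ⟨-, h1⟩ := mem_labelledLists.1 hσ
    obtain ⟨-, h2, h3⟩ := hsupp σ hmσ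
    refine hV σ h2 h3 (fun k => ?_) ?_
    · have : some k ∈ σ.map lab := by rw [h1]; simp [hL]
      obtain ⟨s, hs, hsk⟩ := List.mem_map.1 this
      exact ⟨s, hs, (firstLabel_eq_some hsk).1⟩
    · have : none ∈ σ.map lab := by rw [h1]; simp [hL]
      obtain ⟨s, hs, hsk⟩ := List.mem_map.1 this
      exact ⟨s, hs, fun k => not_lt.1 (firstLabel_eq_none hsk k (List.mem_finRange k))⟩
  -- invariance of the coefficients
  have hinv : ∀ σ ∈ T, m σ ≠ 0 → m (σ.map G) = m σ := by
    intro σ hσ hmσ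
    have hσV := hTV σ hσ hmσ
    have hsup : ∀ l : List (Fin n → ℝ), Alt ((σ.map G).map ind) (l.map r) ≠ 0 →
        ∀ y ∈ l, dist y x₀ ≤ ρ / 2 ∧ y ∈ C := by
      intro l hl y hy
      obtain ⟨f, hf, hfy⟩ := exists_col_of_Alt_ne_zero hl (List.mem_map_of_mem hy)
      simp only [List.map_map, List.mem_map, Function.comp_apply] at hf
      obtain ⟨s, hs, rfl⟩ := hf
      refine hVC s (hσV s hs) y ?_
      by_contra hne
      exact hfy (if_neg hne)
    have h1 := integ_comp (φ := fun l : List (Fin n → ℝ) => Alt ((σ.map G).map ind) (l.map r))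
      hc hN hcN hρc hτρ hq
      (isAlt_map (isAlt_Alt _) r) (fun l hl y hy => (hsup l hl y hy).1) ?_ hG hbd hloc
    · simp only [hm]
      rw [← h1]
      refine integ_congr hc hN fun l hl => ?_
      have h2 : (l.map G).map r = (l.map r).map G := by
        simp only [List.map_map]
        exact List.map_congr_left fun y hy => hrG y (hcU y (hl y hy))
      rw [h2, Alt_map, List.map_map, List.map_map]
      refine Alt_map_congr fun s hs x hx => ?_
      obtain ⟨y, hy, rfl⟩ := List.mem_map.1 hx
      have hsU := hVU (hσV s hs)
      have hyU := hrU y (hcU y (hl y hy))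
      simp only [Function.comp_apply, ind]
      exact if_congr ⟨hGinj _ hyU _ hsU, fun h => by rw [h]⟩ rfl rfl
    · intro l hll hl1 hl2
      by_contra h0
      have h3 : ∃ m : List (Fin n → ℝ), m.Sublist l ∧ m.length + 1 = l.length ∧
          Alt ((σ.map G).map ind) (m.map r) ≠ 0 := by
        by_contra! hcon
        exact h0 (wdl_eq_zero hcon)
      obtain ⟨m, hml, hmlen, hm0⟩ := h3
      obtain ⟨y, hy⟩ := List.exists_mem_of_length_pos (l := m) (by omega)
      have h4 := hgood l hll hl1 hl2 ⟨y, hml.subset hy, (hsup m hm0 y hy).2⟩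
      refine h0 ?_
      have h5 := ((isAlt_Alt ((σ.map G).map ind)).wdl fun _ => 1).eq_zero_of_not_nodup h4
      rwa [wdl_map] at h5
  rw [hexp, ← Finset.sum_filter_ne_zero]
  have hiter : ∀ (k : ℕ) (σ : List (Fin n → ℝ)), (List.map G)^[k] σ = σ.map G^[k] := by
    intro k
    induction k with
    | zero => simp
    | succ k ih => intro σ; rw [Function.iterate_succ_apply, ih, List.map_map]; rfl
  refine dvd_sum_of_free hp (γ := List.map G) ?_ ?_ ?_ ?_
  · intro σ hσ
    rw [Finset.mem_filter] at hσ ⊢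
    have h1 := hinv σ hσ.1 hσ.2
    have h2 : m (σ.map G) ≠ 0 := h1.trans_ne hσ.2
    refine ⟨mem_labelledLists.2 ⟨(hsupp _ h2).1, ?_⟩, h2⟩
    rw [← (mem_labelledLists.1 hσ.1).2, List.map_map]
    refine List.map_congr_left fun s hs => ?_
    simp only [Function.comp_apply, hlab]
    rw [hhG s (hVU (hTV σ hσ.1 hσ.2 s hs))]
  · intro σ hσ
    rw [Finset.mem_filter] at hσ
    rw [hiter]
    conv_rhs => rw [← List.map_id σ]
    exact List.map_congr_left fun s hs => hGp s (hVU (hTV σ hσ.1 hσ.2 s hs))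
  · intro σ hσ heq
    rw [Finset.mem_filter] at hσ
    have h1 := congrArg List.length (mem_labelledLists.1 hσ.1).2
    obtain ⟨s, hs⟩ := List.exists_mem_of_length_pos (l := σ) (by
      rw [List.length_map] at h1; rw [h1]; simp [hL])
    have h2 : σ.map G = σ.map id := by rw [List.map_id]; exact heq
    exact hVfree s (hTV σ hσ.1 hσ.2 s hs) (List.map_inj_left.1 h2 s hs)
  · intro σ hσ
    rw [Finset.mem_filter] at hσ
    exact hinv σ hσ.1 hσ.2

end

section

lemma exists_good_colour {n : ℕ} (t : Fin n → ℝ) :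
    ∃ k : Fin (n + 1), ∀ i (m : ℤ), 1 / (2 * (n + 1) : ℝ) ≤ |t i - k / (n + 1) - m| := by
  by_contra! hcon
  choose i m him using hcon
  obtain ⟨k, k', hne, hk⟩ := Fintype.exists_ne_map_eq_of_card_lt i (by simp)
  have h1 := him k
  have h2 := him k'
  rw [← hk] at h2
  have hn : (0 : ℝ) < n + 1 := by positivity
  have h3 : |(k' : ℝ) / (n + 1) - k / (n + 1) + (m k' - m k)| < 1 / (n + 1) := by
    have h4 := abs_sub (t (i k) - k / (n + 1) - m k) (t (i k) - k' / (n + 1) - m k')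
    have h5 : (1 : ℝ) / (2 * (n + 1)) + 1 / (2 * (n + 1)) = 1 / (n + 1) := by field_simp; norm_num
    have h6 : (k' : ℝ) / (n + 1) - k / (n + 1) + (m k' - m k) =
      (t (i k) - k / (n + 1) - m k) - (t (i k) - k' / (n + 1) - m k') := by ring
    rw [h6]
    linarith
  have h4 : |(k' : ℝ) - k + (n + 1) * (m k' - m k)| < 1 := by
    have h5 : (k' : ℝ) - k + (n + 1) * (m k' - m k) =
      ((k' : ℝ) / (n + 1) - k / (n + 1) + (m k' - m k)) * (n + 1) := by field_simp
    rw [h5, abs_mul, abs_of_pos hn]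
    rwa [lt_div_iff₀ hn] at h3
  have h5 : |((k' : ℕ) : ℤ) - (k : ℕ) + (n + 1) * (m k' - m k)| < 1 := by exact_mod_cast h4
  have h6 := Int.abs_lt_one_iff.1 h5
  have hk1 := k.2
  have hk2 := k'.2
  have h7 : m k' - m k = 0 := by
    rcases lt_trichotomy (m k' - m k) 0 with h | h | h
    · nlinarith
    · exact h
    · nlinarith
  rw [h7] at h6
  exact hne (Fin.ext (by omega))

lemma not_nodup_map {A B : Type*} {l : List A} {f : A → B} {a b : Fin l.length} (hab : a ≠ b)
    (h : f l[a] = f l[b]) : ¬ (l.map f).Nodup := fun hnd => by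
  rw [List.nodup_iff_injective_getElem] at hnd
  have h1 := @hnd ⟨a, by simp⟩ ⟨b, by simp⟩ (by simpa using h)
  exact hab (Fin.ext (Fin.mk.inj h1))

lemma exists_code (n : ℕ) {s : ℝ} (hs : 0 < s) :
    ∃ code : (Fin n → ℝ) → Fin (n + 1) × (Fin n → ℤ),
      (∀ y y', code y = code y' → dist y y' ≤ s) ∧
      ∃ ε > 0, ∀ l : List (Fin n → ℝ), l.length = n + 2 → (∀ y ∈ l, ∀ y' ∈ l, dist y y' ≤ ε) →
        ¬ (l.map code).Nodup := by
  choose k hk using fun y : Fin n → ℝ => exists_good_colour fun i => y i / s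
  refine ⟨fun y => (k y, fun i => ⌊y i / s - k y / (n + 1)⌋), fun y y' h => ?_,
    s / (4 * (n + 1)), by positivity, fun l hl hlε hnd => ?_⟩
  · rw [Prod.mk.injEq] at h
    obtain ⟨h1, h2⟩ := h
    rw [dist_pi_le_iff hs.le]
    intro i
    have h3 := Int.abs_sub_lt_one_of_floor_eq_floor (congrFun h2 i)
    rw [← h1] at h3
    rw [Real.dist_eq]
    have h4 : y i / s - k y / (n + 1) - (y' i / s - k y / (n + 1)) = (y i - y' i) / s := by ring
    rw [h4, abs_div, abs_of_pos hs, div_lt_one hs] at h3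
    exact h3.le
  · obtain ⟨a, b, hne, hab⟩ := Fintype.exists_ne_map_eq_of_card_lt
      (fun a : Fin l.length => k l[a]) (by simp [hl])
    refine not_nodup_map hne ?_ hnd
    · rw [Prod.mk.injEq]
      refine ⟨hab, funext fun i => ?_⟩
      rw [← hab]
      have h3 := (dist_le_pi_dist _ _ i).trans (hlε l[a] (by simp) l[b] (by simp))
      set y := l[a]
      set y' := l[b]
      have h4 := hk y i
      rw [Real.dist_eq] at h3
      have h5 : |(y i / s - k y / (n + 1)) - (y' i / s - k y / (n + 1))| < 1 / (2 * (n + 1)) := by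
        have h6 : y i / s - k y / (n + 1) - (y' i / s - k y / (n + 1)) = (y i - y' i) / s := by ring
        rw [h6, abs_div, abs_of_pos hs, div_lt_iff₀ hs]
        refine h3.trans_lt ?_
        rw [div_lt_iff₀ (by positivity)]
        have : 1 / (2 * ((n : ℝ) + 1)) * s * (4 * (n + 1)) = 2 * s := by field_simp; norm_num
        rw [this]
        linarith
      set u := y i / s - k y / (n + 1)
      set u' := y' i / s - k y / (n + 1)
      have h6 := h4 ⌊u⌋
      have h7 := h4 (⌊u⌋ + 1)
      rw [abs_of_nonneg (by linarith [Int.floor_le u])] at h6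
      rw [abs_of_nonpos (by push_cast; linarith [Int.lt_floor_add_one u])] at h7
      push_cast at h7
      rw [abs_lt] at h5
      symm
      rw [Int.floor_eq_iff]
      constructor <;> linarith

end

section

lemma exists_modulus {A B : Type*} [PseudoMetricSpace A] [PseudoMetricSpace B] {K : Set A}
    (hK : IsCompact K) {f : A → B} (hf : ContinuousOn f K) {η : ℝ} (hη : 0 < η) :
    ∃ δ > 0, ∀ x ∈ K, ∀ y ∈ K, dist x y ≤ δ → dist (f x) (f y) ≤ η :=
  Metric.uniformContinuousOn_iff_le.1 (hK.uniformContinuousOn_of_continuous hf) η hη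

lemma exists_pos_forall_lt {P : ℕ → ℝ → Prop} (hP : ∀ i s t, 0 < t → t ≤ s → P i s → P i t)
    (h : ∀ i, ∃ s > 0, P i s) (p : ℕ) : ∃ s > 0, ∀ i < p, P i s := by
  induction p with
  | zero => exact ⟨1, one_pos, by simp⟩
  | succ p ih =>
    obtain ⟨s, hs, hs'⟩ := ih
    obtain ⟨t, ht, ht'⟩ := h p
    refine ⟨min s t, lt_min hs ht, fun i hi => ?_⟩
    rcases Nat.lt_succ_iff_lt_or_eq.1 hi with h | rfl
    · exact hP i s _ (lt_min hs ht) (min_le_left _ _) (hs' i h)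
    · exact hP i t _ (lt_min hs ht) (min_le_right _ _) ht'

variable {n : ℕ}

/-- A `G`-equivariant map near the identity that identifies two of any `n + 2` close points as
soon as one of them lies in `A`. -/
structure IsCollapse (G r : (Fin n → ℝ) → Fin n → ℝ) (U A : Set (Fin n → ℝ)) (η ε : ℝ) :
    Prop where
  mapsTo : ∀ y ∈ U, r y ∈ U
  comm : ∀ y ∈ U, r (G y) = G (r y)
  dist_le : ∀ y, dist (r y) y ≤ η
  not_nodup : ∀ l : List (Fin n → ℝ), l.length = n + 2 → (∀ y ∈ l, y ∈ U) →
    (∀ y ∈ l, ∀ y' ∈ l, dist y y' ≤ ε) → (∃ y ∈ l, y ∈ A) → ¬ (l.map r).Nodup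

lemma exists_collapse_nhds {U : Set (Fin n → ℝ)} {G : (Fin n → ℝ) → Fin n → ℝ} {p : ℕ}
    (hp : p.Prime) (hU : IsOpen U) (hGU : ∀ y ∈ U, G y ∈ U) (hGc : ContinuousOn G U)
    (hGp : ∀ y ∈ U, G^[p] y = y) {a : Fin n → ℝ} (ha : a ∈ U) (hGa : G a ≠ a) :
    ∃ ρ > 0, ∀ η > 0, ∃ r ε, 0 < ε ∧ IsCollapse G r U (Metric.ball a ρ) η ε := by
  classical
  have hUi : ∀ i, ∀ y ∈ U, G^[i] y ∈ U := fun i => Set.MapsTo.iterate hGU i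
  have hci : ∀ i, ContinuousOn G^[i] U := fun i => hGc.iterate hGU i
  have hmod : ∀ i, ∀ y ∈ U, G^[i % p] y = G^[i] y := fun i y hy =>
    Function.IsPeriodicPt.iterate_mod_apply (hGp y hy) i
  have hmul : ∀ i, ∀ y ∈ U, G^[p * i] y = y := fun i y hy => by
    rw [← hmod _ y hy, Nat.mul_mod_right, Function.iterate_zero, id]
  have hafree : ∀ i, G^[i] a = a → p ∣ i := by
    intro i hi
    have h1 : Function.minimalPeriod G a ∣ i := Function.IsPeriodicPt.minimalPeriod_dvd hi
    have h2 : Function.minimalPeriod G a ∣ p := Function.IsPeriodicPt.minimalPeriod_dvd (hGp a ha)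
    rcases (Nat.dvd_prime hp).1 h2 with h | h
    · exact absurd (Function.minimalPeriod_eq_one_iff_isFixedPt.1 h) hGa
    · rwa [h] at h1
  obtain ⟨ρ, hρ, hρU, hBfree⟩ : ∃ ρ > 0, Metric.closedBall a ρ ⊆ U ∧ ∀ i < p, 0 < i →
      ∀ y ∈ Metric.closedBall a ρ, G^[i] y ∉ Metric.closedBall a ρ := by
    obtain ⟨ρ₁, hρ₁, h₁⟩ := Metric.nhds_basis_closedBall.mem_iff.1 (hU.mem_nhds ha)
    obtain ⟨ρ₂, hρ₂, h₂⟩ := exists_pos_forall_lt (p := p) (P := fun i s => ¬ p ∣ i →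
      ∀ y ∈ Metric.closedBall a s, G^[i] y ∉ Metric.closedBall a s)
      (fun i s t ht hts h hi y hy hy' => h hi y (Metric.closedBall_subset_closedBall hts hy)
        (Metric.closedBall_subset_closedBall hts hy')) (fun i => by
        by_cases hi : p ∣ i
        · exact ⟨1, one_pos, fun h => absurd hi h⟩
        obtain ⟨u, v, hu, hv, hau, hav, huv⟩ := t2_separation fun h => hi (hafree i h)
        have h3 : ∀ᶠ y in nhds a, y ∈ v ∧ G^[i] y ∈ u :=
          (hv.eventually_mem hav).and (((hci i).continuousAt (hU.mem_nhds ha)).eventually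
            (hu.mem_nhds hau))
        obtain ⟨s, hs, hs'⟩ := Metric.nhds_basis_closedBall.eventually_iff.1 h3
        exact ⟨s, hs, fun _ y hy hy' => Set.disjoint_left.1 huv (hs' hy).2 (hs' hy').1⟩)
    refine ⟨min ρ₁ ρ₂, lt_min hρ₁ hρ₂,
      (Metric.closedBall_subset_closedBall (min_le_left _ _)).trans h₁, fun i hi h0 y hy hy' => ?_⟩
    have h3 := Metric.closedBall_subset_closedBall (x := a) (min_le_right ρ₁ ρ₂)
    exact h₂ i hi (fun h => (Nat.le_of_dvd h0 h).not_gt hi) y (h3 hy) (h3 hy')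
  set B := Metric.closedBall a ρ with hB
  have hBdvd : ∀ i, ∀ y ∈ B, G^[i] y ∈ B → p ∣ i := by
    intro i y hy hy'
    rw [← hmod i y (hρU hy)] at hy'
    rw [Nat.dvd_iff_mod_eq_zero]
    by_contra h
    exact hBfree _ (Nat.mod_lt _ hp.pos) (Nat.pos_of_ne_zero h) y hy hy'
  have hdvd : ∀ i, ∀ y ∈ U, p ∣ i → G^[i] y = y := by
    rintro _ y hy ⟨j, rfl⟩
    exact hmul j y hy
  have hK : ∀ i j, ∀ y ∈ B, ∀ y' ∈ B, G^[i] y = G^[j] y' →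
      y = y' ∧ ∀ z ∈ U, G^[i] z = G^[j] z := by
    intro i j y hy y' hy' h
    have hpi : (p - 1) * i + i = p * i := by
      obtain ⟨k, hk⟩ := Nat.exists_eq_succ_of_ne_zero hp.ne_zero
      rw [hk, Nat.succ_sub_one, Nat.succ_mul]
    have h1 : y = G^[(p - 1) * i + j] y' := by
      rw [Function.iterate_add_apply, ← h, ← Function.iterate_add_apply, hpi, hmul i y (hρU hy)]
    have h2 : p ∣ (p - 1) * i + j := hBdvd _ y' hy' (h1 ▸ hy)
    refine ⟨h1.trans (hdvd _ _ (hρU hy') h2), fun z hz => ?_⟩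
    conv_lhs => rw [← hdvd _ z hz h2, ← Function.iterate_add_apply]
    rw [show i + ((p - 1) * i + j) = p * i + j by omega, Function.iterate_add_apply,
      hmul i _ (hUi j z hz)]
  refine ⟨ρ / 2, half_pos hρ, fun η hη => ?_⟩
  obtain ⟨s, hs, hsη⟩ := exists_pos_forall_lt (p := p) (P := fun i s => ∀ x ∈ B, ∀ y ∈ B,
      dist x y ≤ s → dist (G^[i] x) (G^[i] y) ≤ η)
    (fun i s t _ hts h x hx y hy hxy => h x hx y hy (hxy.trans hts))
    (fun i => exists_modulus (isCompact_closedBall a ρ) ((hci i).mono hρU) hη)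
  obtain ⟨code, hcode, ε, hε, hgood⟩ := exists_code n hs
  set b : (Fin n → ℝ) → Fin n → ℝ := fun y => Function.invFunOn code B (code y) with hb
  have hbB : ∀ y ∈ B, b y ∈ B := fun y hy => Function.invFunOn_mem ⟨y, hy, rfl⟩
  have hbs : ∀ y ∈ B, dist (b y) y ≤ s := fun y hy =>
    hcode _ _ (Function.invFunOn_eq ⟨y, hy, rfl⟩)
  set r : (Fin n → ℝ) → Fin n → ℝ := fun x =>
    if h : ∃ iy : ℕ × (Fin n → ℝ), iy.2 ∈ B ∧ G^[iy.1] iy.2 = x then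
      G^[h.choose.1] (b h.choose.2) else x with hr
  have hr1 : ∀ i, ∀ y ∈ B, r (G^[i] y) = G^[i] (b y) := by
    intro i y hy
    have h : ∃ iy : ℕ × (Fin n → ℝ), iy.2 ∈ B ∧ G^[iy.1] iy.2 = G^[i] y := ⟨(i, y), hy, rfl⟩
    simp only [hr]
    rw [dif_pos h]
    obtain ⟨h1, h2⟩ := hK _ _ _ h.choose_spec.1 _ hy h.choose_spec.2
    rw [h1]
    exact h2 _ (hρU (hbB y hy))
  have hr2 : ∀ x, (¬ ∃ iy : ℕ × (Fin n → ℝ), iy.2 ∈ B ∧ G^[iy.1] iy.2 = x) → r x = x :=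
    fun x hx => dif_neg hx
  refine ⟨r, min ε (ρ / 2), lt_min hε (half_pos hρ), ⟨fun x hx => ?_, fun x hx => ?_, fun x => ?_,
    fun l hl hlU hlε ⟨y₀, hy₀, hy₀B⟩ hnd => ?_⟩⟩
  · by_cases h : ∃ iy : ℕ × (Fin n → ℝ), iy.2 ∈ B ∧ G^[iy.1] iy.2 = x
    · obtain ⟨⟨i, y⟩, hy, rfl⟩ := h
      rw [hr1 i y hy]
      exact hUi i _ (hρU (hbB y hy))
    · rwa [hr2 x h]
  · by_cases h : ∃ iy : ℕ × (Fin n → ℝ), iy.2 ∈ B ∧ G^[iy.1] iy.2 = x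
    · obtain ⟨⟨i, y⟩, hy, rfl⟩ := h
      simp only
      rw [hr1 i y hy, ← Function.iterate_succ_apply' G, hr1 _ y hy, Function.iterate_succ_apply' G]
    · rw [hr2 x h, hr2]
      rintro ⟨⟨i, y⟩, hy, hxy⟩
      refine h ⟨(p - 1 + i, y), hy, ?_⟩
      simp only at hxy ⊢
      rw [Function.iterate_add_apply, hxy, ← Function.iterate_succ_apply,
        show (p - 1).succ = p from Nat.succ_pred_eq_of_pos hp.pos, hGp x hx]
  · by_cases h : ∃ iy : ℕ × (Fin n → ℝ), iy.2 ∈ B ∧ G^[iy.1] iy.2 = x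
    · obtain ⟨⟨i, y⟩, hy, rfl⟩ := h
      simp only
      rw [hr1 i y hy, ← hmod i _ (hρU hy), ← hmod i _ (hρU (hbB y hy))]
      exact hsη _ (Nat.mod_lt _ hp.pos) _ (hbB y hy) _ hy (hbs y hy)
    · rw [hr2 x h, dist_self]
      exact hη.le
  · have hlB : ∀ y ∈ l, y ∈ B := fun y hy => by
      have h1 := hlε y hy y₀ hy₀
      have h2 := min_le_right ε (ρ / 2)
      rw [Metric.mem_ball] at hy₀B
      rw [hB, Metric.mem_closedBall]
      linarith [dist_triangle y y₀ a]
    have h1 : l.map r = (l.map code).map (Function.invFunOn code B) := by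
      rw [List.map_map]
      exact List.map_congr_left fun y hy => hr1 0 y (hlB y hy)
    rw [h1] at hnd
    exact hgood l hl (fun y hy y' hy' => (hlε y hy y' hy').trans (min_le_left _ _)) hnd.of_map

lemma exists_collapse {U : Set (Fin n → ℝ)} {G : (Fin n → ℝ) → Fin n → ℝ} {p : ℕ}
    (hp : p.Prime) (hU : IsOpen U) (hGU : ∀ y ∈ U, G y ∈ U) (hGc : ContinuousOn G U)
    (hGp : ∀ y ∈ U, G^[p] y = y) {C : Set (Fin n → ℝ)} (hC : IsCompact C) (hCU : C ⊆ U)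
    (hGC : ∀ y ∈ C, G y ≠ y) {η : ℝ} (hη : 0 < η) :
    ∃ r ε, 0 < ε ∧ IsCollapse G r U C η ε := by
  suffices h : ∃ δ > 0, ∀ η > 0, ∃ r ε, 0 < ε ∧ IsCollapse G r U (Metric.thickening δ C) η ε by
    obtain ⟨δ, hδ, h⟩ := h
    obtain ⟨r, ε, hε, h⟩ := h η hη
    exact ⟨r, ε, hε, h.mapsTo, h.comm, h.dist_le, fun l h1 h2 h3 ⟨y, hy, hyC⟩ =>
      h.not_nodup l h1 h2 h3 ⟨y, hy, Metric.self_subset_thickening hδ C hyC⟩⟩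
  refine hC.induction_on (p := fun C => ∃ δ > 0, ∀ η > 0, ∃ r ε, 0 < ε ∧
    IsCollapse G r U (Metric.thickening δ C) η ε) ?_ ?_ ?_ ?_
  · refine ⟨1, one_pos, fun η hη => ⟨id, 1, one_pos, fun _ h => h, fun _ _ => rfl, fun y => ?_, ?_⟩⟩
    · simpa using hη.le
    · rintro l - - - ⟨y, -, hy⟩
      simp at hy
  · rintro s t hst ⟨δ, hδ, h⟩
    refine ⟨δ, hδ, fun η hη => ?_⟩
    obtain ⟨r, ε, hε, h⟩ := h η hη
    exact ⟨r, ε, hε, h.mapsTo, h.comm, h.dist_le, fun l h1 h2 h3 ⟨y, hy, hyC⟩ =>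
      h.not_nodup l h1 h2 h3 ⟨y, hy, Metric.thickening_subset_of_subset δ hst hyC⟩⟩
  · rintro s t ⟨δ₁, hδ₁, h₁⟩ ⟨δ₂, hδ₂, h₂⟩
    refine ⟨min δ₁ (δ₂ / 2), lt_min hδ₁ (half_pos hδ₂), fun η hη => ?_⟩
    obtain ⟨r₂, ε₂, hε₂, h₂⟩ := h₂ (η / 2) (half_pos hη)
    obtain ⟨r₁, ε₁, hε₁, h₁⟩ := h₁ (min (η / 2) (min (ε₂ / 3) (δ₂ / 2))) (by positivity)
    have hm1 := min_le_left (η / 2) (min (ε₂ / 3) (δ₂ / 2))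
    have hm2 := (min_le_right (η / 2) (min (ε₂ / 3) (δ₂ / 2))).trans (min_le_left _ _)
    have hm3 := (min_le_right (η / 2) (min (ε₂ / 3) (δ₂ / 2))).trans (min_le_right _ _)
    refine ⟨r₂ ∘ r₁, min ε₁ (ε₂ / 3), by positivity, fun y hy => h₂.mapsTo _ (h₁.mapsTo y hy),
      fun y hy => ?_, fun y => ?_, fun l hl hlU hlε ⟨y, hy, hyC⟩ => ?_⟩
    · simp only [Function.comp_apply]
      rw [h₁.comm y hy, h₂.comm _ (h₁.mapsTo y hy)]
    · have := h₁.dist_le y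
      have := h₂.dist_le (r₁ y)
      simp only [Function.comp_apply]
      linarith [dist_triangle (r₂ (r₁ y)) (r₁ y) y]
    · rw [← List.map_map]
      rw [Metric.thickening_union] at hyC
      rcases hyC with hyC | hyC
      · intro hnd
        exact h₁.not_nodup l hl hlU (fun y hy y' hy' => (hlε y hy y' hy').trans (min_le_left _ _))
          ⟨y, hy, Metric.thickening_mono (min_le_left _ _) s hyC⟩ hnd.of_map
      · refine h₂.not_nodup (l.map r₁) (by simpa) ?_ ?_ ⟨r₁ y, List.mem_map_of_mem hy, ?_⟩
        · intro z hz
          obtain ⟨w, hw, rfl⟩ := List.mem_map.1 hz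
          exact h₁.mapsTo w (hlU w hw)
        · intro z hz z' hz'
          obtain ⟨w, hw, rfl⟩ := List.mem_map.1 hz
          obtain ⟨w', hw', rfl⟩ := List.mem_map.1 hz'
          have e1 := h₁.dist_le w
          have e2 := h₁.dist_le w'
          rw [dist_comm] at e2
          have e3 := (hlε w hw w' hw').trans (min_le_right _ _)
          linarith [dist_triangle4 (r₁ w) w w' (r₁ w')]
        · obtain ⟨z, hz, hyz⟩ := Metric.mem_thickening_iff.1 hyC
          refine Metric.mem_thickening_iff.2 ⟨z, hz, ?_⟩
          have e1 := h₁.dist_le y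
          have e2 := min_le_right δ₁ (δ₂ / 2)
          linarith [dist_triangle (r₁ y) y z]
  · intro a ha
    obtain ⟨ρ, hρ, h⟩ := exists_collapse_nhds hp hU hGU hGc hGp (hCU ha) (hGC a ha)
    refine ⟨Metric.ball a (ρ / 2), mem_nhdsWithin_of_mem_nhds (Metric.ball_mem_nhds a (half_pos hρ)),
      ρ / 2, half_pos hρ, fun η hη => ?_⟩
    obtain ⟨r, ε, hε, h⟩ := h η hη
    refine ⟨r, ε, hε, h.mapsTo, h.comm, h.dist_le, fun l h1 h2 h3 ⟨y, hy, hyC⟩ =>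
      h.not_nodup l h1 h2 h3 ⟨y, hy, ?_⟩⟩
    obtain ⟨z, hz, hyz⟩ := Metric.mem_thickening_iff.1 hyC
    rw [Metric.mem_ball] at hz ⊢
    linarith [dist_triangle y z a]

end

section

variable {n : ℕ}

lemma integ_degForm_perturb {x₀ q q' : Fin n → ℝ} {c τ ρ : ℝ} {N : ℤ} (hc : 0 < c) (hN : 1 ≤ N)
    (hcN : c / N ≤ τ) (hρ : 0 < ρ) (hρc : ρ ≤ c) (hτρ : τ ≤ ρ / 8) (hq : dist q x₀ ≤ ρ / 8)
    (hq' : dist q' x₀ ≤ ρ / 8) {h r : (Fin n → ℝ) → Fin n → ℝ}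
    (hr : ∀ y, dist y x₀ ≤ c → dist (h (r y)) (h y) ≤ ρ / 8)
    (hh : ∀ x y, dist x x₀ ≤ c → dist y x₀ ≤ c → dist x y ≤ c / N → dist (h x) (h y) ≤ τ)
    (hbd : ∀ x, dist x x₀ = c → ρ ≤ dist (h x) x₀)
    (hloc : ∀ x, dist x x₀ ≤ c → h x ≠ x → τ < dist (h x) q ∧ τ < dist x q) :
    integ x₀ c N (fun l => degForm (l.map fun y => h (r y) - q')) = (-1) ^ n := by
  have hz0 : ∀ d : Fin n ⊕ Fin n, |(0 : Fin n ⊕ Fin n → ℤ) d| ≤ N := fun d => by simp; omega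
  set X : (Fin n ⊕ Fin n → ℤ) → Fin n → ℝ := latPt x₀ c N Sum.inl with hX
  have hXc : ∀ z, Adm N 0 (dirs Sum.inl) [z] → dist (X z) x₀ ≤ c :=
    fun z hz => latPt_mem hc.le hN hz
  have hX2 : ∀ z w, Adm N 0 (dirs Sum.inl) [z, w] → dist (h (X z)) (h (X w)) ≤ τ := fun z w hzw =>
    hh _ _ (hXc z (hzw.sublist (by simp))) (hXc w (hzw.sublist (by simp)))
      (latPt_close hc.le hN hzw)
  rw [← cube_degForm_eval (x₀ := x₀) hc hN hz0 (Sum.inl_injective (α := Fin n) (β := Fin n))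
    (q := q) (by linarith), ← cube_degForm_local (a := fun z => h (X z) - q) (η := τ) hz0,
    ← cube_degForm_homotopy (a := fun z => h (r (X z)) - q') (v := fun z => h (X z) - x₀)
    (r := ρ / 4) (η := τ) (by omega) hz0 (dirs_nodup Sum.inl_injective)]
  · simp only [integ, List.map_map]
    rfl
  · intro z hz
    have h1 := hr (X z) (hXc z hz)
    calc dist (h (r (X z)) - q') (h (X z) - x₀) ≤ dist (h (r (X z))) (h (X z)) + dist q' x₀ :=
          dist_sub_sub_le _ _ _ _
      _ ≤ ρ / 4 := by linarith
  · intro z hz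
    rw [dist_sub_left]
    linarith
  · intro z w hzw
    rw [dist_sub_right]
    exact hX2 z w hzw
  · rintro z hz ⟨d, hd, hzd⟩
    obtain ⟨k, rfl⟩ := mem_dirs.1 hd
    have h1 := latPt_bdry (x₀ := x₀) (ι := Sum.inl) hc.le hN (hzd z (by simp))
    have h2 := hbd (X z) (le_antisymm (hXc z hz) h1)
    rw [← dist_eq_norm]
    linarith
  · intro z w hzw
    rw [dist_sub_right]
    exact hX2 z w hzw
  · intro z w hzw
    rw [dist_sub_right]
    exact (latPt_close hc.le hN hzw).trans hcN
  · intro z hz hne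
    rw [← dist_eq_norm, ← dist_eq_norm]
    exact hloc (X z) (hXc z hz) fun h => hne (by simp only [h]; rfl)

lemma exists_dist_lower_bound {A B : Type*} [TopologicalSpace A] [MetricSpace B] {K : Set A}
    (hK : IsCompact K) {f : A → B} (hf : ContinuousOn f K) {q : B} (hq : ∀ y ∈ K, f y ≠ q) :
    ∃ ρ > 0, ∀ y ∈ K, ρ ≤ dist (f y) q := by
  rcases K.eq_empty_or_nonempty with rfl | hne
  · exact ⟨1, one_pos, by simp⟩
  · obtain ⟨y, hy, hmin⟩ := hK.exists_isMinOn hne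
      ((continuous_id.dist (continuous_const (y := q))).comp_continuousOn hf)
    exact ⟨dist (f y) q, dist_pos.2 (hq y hy), fun z hz => hmin hz⟩

/-- The mean of the `G`-orbit of a point. -/
noncomputable def orbitMean (G : (Fin n → ℝ) → Fin n → ℝ) (p : ℕ) (y : Fin n → ℝ) : Fin n → ℝ :=
  ∑ i ∈ Finset.range p, (p : ℝ)⁻¹ • G^[i] y

lemma orbitMean_apply_eq {G : (Fin n → ℝ) → Fin n → ℝ} {p : ℕ} {y : Fin n → ℝ}
    (hy : G^[p] y = y) : orbitMean G p (G y) = orbitMean G p y := by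
  have h := Finset.sum_range_succ' (fun i => (p : ℝ)⁻¹ • G^[i] y) p
  rw [Finset.sum_range_succ, hy] at h
  exact (add_right_cancel h).symm

lemma orbitMean_of_fixed {G : (Fin n → ℝ) → Fin n → ℝ} {p : ℕ} (hp : p ≠ 0) {y : Fin n → ℝ}
    (hy : G y = y) : orbitMean G p y = y := by
  have h : ∀ i, G^[i] y = y := fun i => Function.iterate_fixed hy i
  have hp' : (p : ℝ) ≠ 0 := by exact_mod_cast hp
  simp only [orbitMean, h]
  rw [Finset.sum_const, Finset.card_range, ← Nat.cast_smul_eq_nsmul ℝ, smul_smul,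
    mul_inv_cancel₀ hp', one_smul]

lemma continuousOn_orbitMean {G : (Fin n → ℝ) → Fin n → ℝ} {p : ℕ} {U : Set (Fin n → ℝ)}
    (hG : ContinuousOn G U) (hGU : ∀ y ∈ U, G y ∈ U) : ContinuousOn (orbitMean G p) U :=
  continuousOn_finsetSum _ fun i _ =>
    (continuous_const_smul (p : ℝ)⁻¹).comp_continuousOn (hG.iterate hGU i)

lemma lt_orbitMean {G : (Fin n → ℝ) → Fin n → ℝ} {p : ℕ} (hp : 1 < p) {Θ : (Fin n → ℝ) → ℝ}
    (hΘ : StrictConvexOn ℝ Set.univ Θ) {y : Fin n → ℝ} (hy : G y ≠ y)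
    (hneg : ∀ i, Θ (G^[i] y) ≤ 0) : Θ (orbitMean G p y) < 0 := by
  have hp' : (0 : ℝ) < p := by exact_mod_cast (by omega : 0 < p)
  have h := hΘ.map_sum_lt (t := Finset.range p) (w := fun _ => (p : ℝ)⁻¹) (p := fun i => G^[i] y)
    (fun _ _ => inv_pos.2 hp') (by simp [hp'.ne']) (fun _ _ => Set.mem_univ _)
    ⟨1, by simpa using hp, 0, by simp; omega, hy⟩
  exact h.trans_le (Finset.sum_nonpos fun i _ =>
    smul_nonpos_of_nonneg_of_nonpos (inv_pos.2 hp').le (hneg i))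

end

section

variable {n : ℕ}

theorem core {U : Set (Fin n → ℝ)} {G : (Fin n → ℝ) → Fin n → ℝ} {p : ℕ} (hp : p.Prime)
    (hU : IsOpen U) (hGU : ∀ y ∈ U, G y ∈ U) (hGc : ContinuousOn G U)
    (hGp : ∀ y ∈ U, G^[p] y = y) {Θ : (Fin n → ℝ) → ℝ} (hΘc : Continuous Θ)
    (hΘ : StrictConvexOn ℝ Set.univ Θ) (hneg : ∀ y ∈ U, G y ≠ y → Θ y ≤ 0) {x₀ : Fin n → ℝ}
    (hx₀ : x₀ ∈ U) (hΘ0 : Θ x₀ = 0) (hfree : x₀ ∈ closure {y | y ∈ U ∧ G y ≠ y})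
    (hpos : x₀ ∈ closure {y | 0 < Θ y}) : False := by
  have hp0 := hp.pos
  have hGinj : ∀ y ∈ U, ∀ y' ∈ U, G y = G y' → y = y' := by
    intro y hy y' hy' h
    have h1 : (p - 1).succ = p := Nat.succ_pred_eq_of_pos hp0
    rw [← hGp y hy, ← hGp y' hy', ← h1, Function.iterate_succ_apply, h,
      ← Function.iterate_succ_apply]
  have hopen : IsOpen {y | y ∈ U ∧ G y ≠ y} := by
    have h1 : ContinuousOn (fun y => G y - y) U := hGc.sub continuousOn_id
    have h2 := h1.isOpen_inter_preimage hU (isOpen_compl_singleton (x := 0))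
    convert h2 using 1
    ext y
    simp [sub_eq_zero]
  have hposopen : IsOpen {y | 0 < Θ y} := isOpen_lt continuous_const hΘc
  have hfix : ∀ y ∈ U, 0 < Θ y → G y = y := fun y hy h => by
    by_contra hne
    exact (hneg y hy hne).not_gt h
  have hGx₀ : G x₀ = x₀ := by
    by_contra hne
    obtain ⟨y, hy, hy'⟩ := mem_closure_iff.1 hpos _ hopen ⟨hx₀, hne⟩
    exact hy.2 (hfix y hy.1 hy')
  have hiter : ∀ y ∈ U, G y ≠ y → ∀ i, G^[i] y ∈ U ∧ G (G^[i] y) ≠ G^[i] y := by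
    intro y hy hne i
    induction i with
    | zero => exact ⟨hy, hne⟩
    | succ i ih =>
      rw [Function.iterate_succ_apply']
      exact ⟨hGU _ ih.1, fun h => ih.2 (hGinj _ (hGU _ ih.1) _ ih.1 h)⟩
  -- the averaged map
  set h := orbitMean G p with hh
  have hhG : ∀ y ∈ U, h (G y) = h y := fun y hy => orbitMean_apply_eq (hGp y hy)
  have hhfix : ∀ y, G y = y → h y = y := fun y hy => orbitMean_of_fixed hp0.ne' hy
  have hhc : ContinuousOn h U := continuousOn_orbitMean hGc hGU
  have hhneg : ∀ y ∈ U, G y ≠ y → Θ (h y) < 0 := fun y hy hne =>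
    lt_orbitMean hp.one_lt hΘ hne fun i => hneg _ (hiter y hy hne i).1 (hiter y hy hne i).2
  have hhnonneg : ∀ y ∈ U, 0 ≤ Θ (h y) → G y = y := fun y hy h0 => by
    by_contra hne
    exact (hhneg y hy hne).not_ge h0
  have hhx₀ : ∀ y ∈ U, h y = x₀ → y = x₀ := fun y hy hy' =>
    (hhfix y (hhnonneg y hy (by rw [hy', hΘ0]))).symm.trans hy'
  have hGx₀' : ∀ y ∈ U, G y = x₀ → y = x₀ := fun y hy hy' =>
    hGinj y hy x₀ hx₀ (hy'.trans hGx₀.symm)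
  -- choice of the cube
  obtain ⟨c, hc, hcU⟩ : ∃ c > 0, Metric.closedBall x₀ (2 * c) ⊆ U := by
    obtain ⟨c, hc, h1⟩ := Metric.nhds_basis_closedBall.mem_iff.1 (hU.mem_nhds hx₀)
    exact ⟨c / 2, half_pos hc, by rwa [mul_div_cancel₀ c two_ne_zero]⟩
  set Q := Metric.closedBall x₀ c with hQ
  have hQU : Q ⊆ U := (Metric.closedBall_subset_closedBall (by linarith)).trans hcU
  have hQc : IsCompact Q := isCompact_closedBall _ _
  obtain ⟨ρ, hρ, hρc, hρG, hρh⟩ : ∃ ρ > 0, ρ ≤ c ∧ (∀ x, dist x x₀ = c → ρ ≤ dist (G x) x₀) ∧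
      ∀ x, dist x x₀ = c → ρ ≤ dist (h x) x₀ := by
    have hS : IsCompact (Metric.sphere x₀ c) := isCompact_sphere _ _
    have hSU : Metric.sphere x₀ c ⊆ U := Metric.sphere_subset_closedBall.trans hQU
    have hSx : ∀ y ∈ Metric.sphere x₀ c, y ≠ x₀ := fun y hy => by
      rintro rfl
      simp at hy
      exact hc.ne hy
    obtain ⟨ρ₁, h1, h1'⟩ := exists_dist_lower_bound hS (hGc.mono hSU) (q := x₀)
      fun y hy hy' => hSx y hy (hGx₀' y (hSU hy) hy')
    obtain ⟨ρ₂, h2, h2'⟩ := exists_dist_lower_bound hS (hhc.mono hSU) (q := x₀)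
      fun y hy hy' => hSx y hy (hhx₀ y (hSU hy) hy')
    exact ⟨min c (min ρ₁ ρ₂), by positivity, min_le_left _ _,
      fun x hx => ((min_le_right _ _).trans (min_le_left _ _)).trans (h1' x hx),
      fun x hx => ((min_le_right _ _).trans (min_le_right _ _)).trans (h2' x hx)⟩
  obtain ⟨c₁, hc₁, hc₁ρ, hc₁G⟩ : ∃ c₁ > 0, c₁ ≤ ρ / 4 ∧
      ∀ y, dist y x₀ < c₁ → dist (G y) x₀ ≤ c := by
    have h1 := hGc.continuousAt (hU.mem_nhds hx₀)
    rw [Metric.continuousAt_iff, hGx₀] at h1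
    obtain ⟨δ, hδ, h1⟩ := h1 c hc
    exact ⟨min δ (ρ / 4), by positivity, min_le_right _ _,
      fun y hy => (h1 (hy.trans_le (min_le_left _ _))).le⟩
  obtain ⟨ρ₂, hρ₂, hρ₂h⟩ : ∃ ρ₂ > 0, ∀ y ∈ Q, c₁ ≤ dist y x₀ → ρ₂ ≤ dist (h y) x₀ := by
    have hK : IsCompact (Q ∩ {y | c₁ ≤ dist y x₀}) :=
      hQc.inter_right (isClosed_le continuous_const (continuous_id.dist continuous_const))
    obtain ⟨ρ₂, h1, h2⟩ := exists_dist_lower_bound hK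
      (hhc.mono (Set.inter_subset_left.trans hQU)) (q := x₀) fun y hy hy' => by
        have h3 := hy.2
        rw [Set.mem_ofPred_eq, hhx₀ y (hQU hy.1) hy', dist_self] at h3
        linarith
    exact ⟨ρ₂, h1, fun y hy hy' => h2 y ⟨hy, hy'⟩⟩
  have hm : 0 < min (ρ / 8) ρ₂ := by positivity
  obtain ⟨q, hqΘ, hq⟩ := Metric.mem_closure_iff.1 hpos _ hm
  obtain ⟨q', ⟨hq'U, hq'G⟩, hq'⟩ := Metric.mem_closure_iff.1 hfree _ hm
  rw [Set.mem_ofPred_eq] at hqΘ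
  rw [dist_comm, lt_min_iff] at hq hq'
  have hqQ : q ∈ Q := by rw [hQ, Metric.mem_closedBall]; linarith
  have hqG : G q = q := hfix q (hQU hqQ) hqΘ
  obtain ⟨τ₀, hτ₀, hτ₀G, hτ₀h⟩ : ∃ τ₀ > 0,
      (∀ x ∈ Q, G x ≠ x → τ₀ ≤ dist (G x) q ∧ τ₀ ≤ dist x q) ∧
      ∀ x ∈ Q, h x ≠ x → τ₀ ≤ dist (h x) q ∧ τ₀ ≤ dist x q := by
    obtain ⟨e, he, h1⟩ := Metric.isOpen_iff.1 (hposopen.inter hU) q ⟨hqΘ, hQU hqQ⟩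
    have h1' : ∀ x ∈ Q, G x ≠ x → e ≤ dist x q := fun x hx hne => by
      by_contra! hlt
      have := h1 (Metric.mem_ball.2 hlt)
      exact hne (hfix x this.2 this.1)
    have hK : IsCompact (Q ∩ {y | e ≤ dist y q}) :=
      hQc.inter_right (isClosed_le continuous_const (continuous_id.dist continuous_const))
    have hKU := (Set.inter_subset_left (s := Q) (t := {y | e ≤ dist y q})).trans hQU
    have hKq : ∀ y ∈ Q ∩ {y | e ≤ dist y q}, y ≠ q := by
      rintro y hy rfl
      have h3 := hy.2
      rw [Set.mem_ofPred_eq, dist_self] at h3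
      linarith
    obtain ⟨a, ha, ha'⟩ := exists_dist_lower_bound hK (hGc.mono hKU) (q := q)
      fun y hy hy' => hKq y hy (hGinj y (hKU hy) q (hQU hqQ) (hy'.trans hqG.symm))
    obtain ⟨b, hb, hb'⟩ := exists_dist_lower_bound hK (hhc.mono hKU) (q := q)
      fun y hy hy' => hKq y hy
        ((hhfix y (hhnonneg y (hKU hy) (by rw [hy']; exact hqΘ.le))).symm.trans hy')
    refine ⟨min e (min a b), by positivity, fun x hx hne => ?_, fun x hx hne => ?_⟩
    · have h2 := h1' x hx hne
      exact ⟨((min_le_right _ _).trans (min_le_left _ _)).trans (ha' x ⟨hx, h2⟩),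
        (min_le_left _ _).trans h2⟩
    · have h2 := h1' x hx fun hG => hne (hhfix x hG)
      exact ⟨((min_le_right _ _).trans (min_le_right _ _)).trans (hb' x ⟨hx, h2⟩),
        (min_le_left _ _).trans h2⟩
  -- the free fibre
  set K := Q ∩ {y | h y = q'} with hK
  have hKc : IsCompact K := by
    have h1 := (hhc.mono hQU).preimage_isClosed_of_isClosed Metric.isClosed_closedBall
      (isClosed_singleton (x := q'))
    exact hQc.of_isClosed_subset h1 Set.inter_subset_left
  set W := {y | dist y x₀ < c₁} ∩ {y | y ∈ U ∧ G y ≠ y} with hW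
  have hWo : IsOpen W :=
    (isOpen_lt (continuous_id.dist continuous_const) continuous_const).inter hopen
  have hKW : K ⊆ W := by
    rintro y ⟨hyQ, hy⟩
    refine ⟨?_, hQU hyQ, fun hG => ?_⟩
    · by_contra hge
      have h1 := hρ₂h y hyQ (not_lt.1 hge)
      rw [hy] at h1
      linarith
    · have h1 := (hhfix y hG).symm.trans hy
      rw [h1] at hG
      exact hq'G hG
  have hKG : ∀ y ∈ K, G y ∈ K := fun y hy =>
    ⟨hc₁G y (hKW hy).1, (hhG y (hQU hy.1)).trans hy.2⟩
  obtain ⟨κ, hκ, hκW⟩ := hKc.exists_cthickening_subset_open hWo hKW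
  set C := Metric.cthickening κ K with hC
  have hCc : IsCompact C := hKc.cthickening
  have hCU : C ⊆ U := fun y hy => (hκW hy).2.1
  obtain ⟨κ₂, hκ₂, hκ₂κ, hκ₂G⟩ : ∃ κ₂ > 0, κ₂ ≤ κ ∧ ∀ s z, z ∈ K → dist s z < κ₂ →
      dist (G s) (G z) ≤ κ / 4 := by
    obtain ⟨δ, hδ, h1⟩ := exists_modulus hCc (hGc.mono hCU) (by positivity : 0 < κ / 4)
    refine ⟨min κ δ, by positivity, min_le_left _ _, fun s z hz hsz => h1 s ?_ z ?_ ?_⟩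
    · exact Metric.thickening_subset_cthickening _ _
        (Metric.mem_thickening_iff.2 ⟨z, hz, hsz.trans_le (min_le_left _ _)⟩)
    · exact Metric.self_subset_cthickening _ hz
    · exact hsz.le.trans (min_le_right _ _)
  set V := Metric.thickening κ₂ K with hV
  have hVW : V ⊆ W := (Metric.thickening_subset_cthickening _ _).trans
    ((Metric.cthickening_mono hκ₂κ _).trans hκW)
  obtain ⟨δ₀, hδ₀, hδ₀h⟩ : ∃ δ₀ > 0, ∀ y ∈ Q, dist (h y) q' < δ₀ →
      y ∈ Metric.thickening (κ₂ / 2) K := by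
    have hK' : IsCompact (Q ∩ (Metric.thickening (κ₂ / 2) K)ᶜ) :=
      hQc.inter_right Metric.isOpen_thickening.isClosed_compl
    obtain ⟨δ, hδ, h1⟩ := exists_dist_lower_bound hK'
      (hhc.mono (Set.inter_subset_left.trans hQU)) (q := q') fun y hy hy' =>
        hy.2 (Metric.self_subset_thickening (by positivity) _ ⟨hy.1, hy'⟩)
    refine ⟨δ, hδ, fun y hy hlt => ?_⟩
    by_contra hne
    exact hlt.not_ge (h1 y ⟨hy, hne⟩)
  obtain ⟨δ, hδ, hδh⟩ := exists_modulus (isCompact_closedBall x₀ (2 * c)) (hhc.mono hcU)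
    (η := min (δ₀ / 4) (ρ / 8)) (by positivity)
  -- the collapse
  obtain ⟨η, hη, hηc, hηκ, hηκ₂, hηδ⟩ : ∃ η > 0, η ≤ c ∧ η ≤ κ / 4 ∧ η ≤ κ₂ / 2 ∧ η ≤ δ / 3 :=
    ⟨min (min c (κ / 4)) (min (κ₂ / 2) (δ / 3)), by positivity,
      (min_le_left _ _).trans (min_le_left _ _), (min_le_left _ _).trans (min_le_right _ _),
      (min_le_right _ _).trans (min_le_left _ _), (min_le_right _ _).trans (min_le_right _ _)⟩
  obtain ⟨r, ε, hε, hr⟩ := exists_collapse hp hU hGU hGc hGp hCc hCU (fun y hy => (hκW hy).2.2) hη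
  have hr2c : ∀ y, dist y x₀ ≤ c → r y ∈ Metric.closedBall x₀ (2 * c) := fun y hy => by
    have h1 := hr.dist_le y
    rw [Metric.mem_closedBall]
    linarith [dist_triangle (r y) y x₀]
  have hQ2c : ∀ y, dist y x₀ ≤ c → y ∈ Metric.closedBall x₀ (2 * c) := fun y hy => by
    rw [Metric.mem_closedBall]
    linarith
  have hhr : ∀ y, dist y x₀ ≤ c → dist (h (r y)) (h y) ≤ min (δ₀ / 4) (ρ / 8) := fun y hy =>
    hδh _ (hr2c y hy) _ (hQ2c y hy) ((hr.dist_le y).trans (by linarith))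
  obtain ⟨τ, hτ, hτε, hτρ, hτη, hτc, hττ₀⟩ : ∃ τ > 0, 3 * τ ≤ ε ∧ 12 * τ ≤ ρ ∧ τ ≤ η ∧
      2 * τ ≤ c ∧ τ < τ₀ := by
    have h1 := min_le_left (min (ε / 3) (ρ / 12)) (min η (min (c / 2) (τ₀ / 2)))
    have h2 := min_le_right (min (ε / 3) (ρ / 12)) (min η (min (c / 2) (τ₀ / 2)))
    have h3 := min_le_left (ε / 3) (ρ / 12)
    have h4 := min_le_right (ε / 3) (ρ / 12)
    have h5 := min_le_left η (min (c / 2) (τ₀ / 2))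
    have h6 := min_le_right η (min (c / 2) (τ₀ / 2))
    have h7 := min_le_left (c / 2) (τ₀ / 2)
    have h8 := min_le_right (c / 2) (τ₀ / 2)
    exact ⟨min (min (ε / 3) (ρ / 12)) (min η (min (c / 2) (τ₀ / 2))), by positivity,
      by linarith, by linarith, by linarith, by linarith, by linarith⟩
  obtain ⟨δ₁, hδ₁, hδ₁G⟩ := exists_modulus hQc (hGc.mono hQU) hτ
  obtain ⟨δ₂, hδ₂, hδ₂h⟩ := exists_modulus hQc (hhc.mono hQU) hτ
  obtain ⟨N, hN, hNτ, hNδ₁, hNδ₂⟩ : ∃ N : ℤ, 1 ≤ N ∧ c / N ≤ τ ∧ c / N ≤ δ₁ ∧ c / N ≤ δ₂ := by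
    have hpos' : 0 < min τ (min δ₁ δ₂) := by positivity
    obtain ⟨N, hN⟩ := exists_nat_gt (c / min τ (min δ₁ δ₂))
    have hN0 : (0 : ℝ) < N := (by positivity : 0 < c / min τ (min δ₁ δ₂)).trans hN
    have h1 : c / ((N : ℤ) : ℝ) ≤ min τ (min δ₁ δ₂) := by
      rw [Int.cast_natCast, div_le_iff₀ hN0, mul_comm, ← div_le_iff₀ hpos']
      exact hN.le
    refine ⟨N, by exact_mod_cast hN0, h1.trans (min_le_left _ _),
      h1.trans ((min_le_right _ _).trans (min_le_left _ _)),
      h1.trans ((min_le_right _ _).trans (min_le_right _ _))⟩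
  have hdvd := dvd_degree (x₀ := x₀) (q := q) (q' := q') (C := C) (V := V) (h := h) (η := η)
    (r := r) hc hN hNτ hρc (by linarith) (by linarith) hp (fun y hy => hQU hy) hGp hGinj
    (fun x y hx hy hxy => hδ₁G x hx y hy (hxy.trans hNδ₁)) hρG
    (fun x hx hne => ⟨hττ₀.trans_le (hτ₀G x hx hne).1, hττ₀.trans_le (hτ₀G x hx hne).2⟩)
    hhG hr.mapsTo hr.comm hr.dist_le ?_ (fun s hs => (hVW hs).2.1) (fun s hs => (hVW hs).2.2)
    ?_ ?_
  · rw [integ_degForm_perturb (q := q) hc hN hNτ hρ hρc (by linarith) (by linarith) (by linarith)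
      (fun y hy => (hhr y hy).trans (min_le_right _ _))
      (fun x y hx hy hxy => hδ₂h x hx y hy (hxy.trans hNδ₂)) hρh
      (fun x hx hne => ⟨hττ₀.trans_le (hτ₀h x hx hne).1, hττ₀.trans_le (hτ₀h x hx hne).2⟩)] at hdvd
    have h1 : (p : ℤ) ∣ 1 := by
      have := hdvd.mul_right ((-1) ^ n)
      rwa [← mul_pow, neg_one_mul, neg_neg, one_pow] at this
    exact hp.one_lt.ne' (by exact_mod_cast Int.eq_one_of_dvd_one (by positivity) h1)
  · intro σ hσ hσd hs1 hs2 s hs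
    obtain ⟨y, hy, rfl⟩ := hσ s hs
    have h1 : ‖h (r y) - q'‖ ≤ δ₀ / 4 := by
      refine norm_le_of_surround (l := σ.map fun s => h s - q') ?_ ?_ ?_
      · intro k
        obtain ⟨s', hs', h1⟩ := hs1 k
        exact ⟨_, List.mem_map_of_mem hs', h1⟩
      · obtain ⟨s', hs', h1⟩ := hs2
        exact ⟨_, List.mem_map_of_mem hs', h1⟩
      · intro z hz
        obtain ⟨s', hs', rfl⟩ := List.mem_map.1 hz
        obtain ⟨y', hy', rfl⟩ := hσ s' hs'
        rw [dist_sub_right]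
        exact (hδh _ (hr2c y' hy') _ (hr2c y hy) ((hσd _ hs' _ hs).trans (by linarith))).trans
          (min_le_left _ _)
    rw [← dist_eq_norm] at h1
    have h2 := (hhr y hy).trans (min_le_left _ _)
    rw [dist_comm] at h2
    have h3 := hδ₀h y hy (by linarith [dist_triangle (h y) (h (r y)) q'])
    obtain ⟨z, hz, hyz⟩ := Metric.mem_thickening_iff.1 h3
    refine Metric.mem_thickening_iff.2 ⟨z, hz, ?_⟩
    linarith [dist_triangle (r y) y z, hr.dist_le y]
  · intro s hs y hy
    obtain ⟨z, hz, hsz⟩ := Metric.mem_thickening_iff.1 hs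
    have h1 := hκ₂G s z hz hsz
    have h2 := hr.dist_le y
    rw [hy, dist_comm] at h2
    have h3 : y ∈ C := Metric.thickening_subset_cthickening _ _
      (Metric.mem_thickening_iff.2 ⟨G z, hKG z hz, by linarith [dist_triangle y (G s) (G z)]⟩)
    refine ⟨?_, h3⟩
    have h4 : dist y x₀ < c₁ := (hκW h3).1
    linarith
  · intro l hl hl1 hl2 hl3
    exact hr.not_nodup l hl (fun y hy => hcU ((hl1 y hy).trans (by linarith)))
      (fun y hy y' hy' => (hl2 y hy y' hy').trans hτε) hl3

end

section

lemma strictConvexOn_comp_equiv {E F : Type*} [AddCommGroup E] [Module ℝ E] [AddCommGroup F]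
    [Module ℝ F] (e : F ≃ₗ[ℝ] E) {Θ : E → ℝ} (hΘ : StrictConvexOn ℝ Set.univ Θ) :
    StrictConvexOn ℝ Set.univ (Θ ∘ e) := by
  refine ⟨convex_univ, fun x _ y _ hxy a b ha hb hab => ?_⟩
  have h := hΘ.2 (Set.mem_univ (e x)) (Set.mem_univ (e y)) (fun h => hxy (e.injective h)) ha hb hab
  simpa using h

lemma strictConvexOn_dist_sq {E : Type*} [NormedAddCommGroup E] [InnerProductSpace ℝ E] (a : E)
    (C : ℝ) : StrictConvexOn ℝ Set.univ fun y => dist y a ^ 2 - C := by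
  refine ⟨convex_univ, fun x _ y _ hxy u v hu hv huv => ?_⟩
  simp only [dist_eq_norm, smul_eq_mul]
  have h1 : u • x + v • y - a = u • (x - a) + v • (y - a) := by
    rw [smul_sub, smul_sub, ← add_sub_add_comm, ← add_smul, huv, one_smul]
  have h2 : 0 < ‖(x - a) - (y - a)‖ ^ 2 := by
    rw [sub_sub_sub_cancel_right]
    have := norm_pos_iff.2 (sub_ne_zero.2 hxy)
    positivity
  rw [h1]
  rw [norm_sub_sq_real] at h2
  rw [norm_add_sq_real, norm_smul, norm_smul, real_inner_smul_left, real_inner_smul_right,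
    Real.norm_of_nonneg hu.le, Real.norm_of_nonneg hv.le]
  have hv' : v = 1 - u := by linarith
  have h3 := mul_pos (mul_pos hu hv) h2
  subst hv'
  nlinarith

/-- The local form of Newman's theorem for a germ of a periodic map of Euclidean space. -/
theorem euclidean_core {E : Type*} [NormedAddCommGroup E] [InnerProductSpace ℝ E]
    [ProperSpace E] {n : ℕ}
    (e : E ≃L[ℝ] (Fin n → ℝ)) {V O : Set E} {G : E → E} {p : ℕ} (hp : p.Prime) (hV : IsOpen V)
    (hGV : ∀ y ∈ V, G y ∈ V) (hGc : ContinuousOn G V) (hGp : ∀ y ∈ V, G^[p] y = y)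
    (hO : IsOpen O) (hGO : ∀ y ∈ O, G y = y) {x : E} (hx : x ∈ V) (hxO : x ∈ closure O)
    (hxG : x ∈ closure {y | y ∈ V ∧ G y ≠ y}) : False := by
  have hGinj : ∀ y ∈ V, ∀ y' ∈ V, G y = G y' → y = y' := by
    intro y hy y' hy' h
    have h1 : (p - 1).succ = p := Nat.succ_pred_eq_of_pos hp.pos
    rw [← hGp y hy, ← hGp y' hy', ← h1, Function.iterate_succ_apply, h,
      ← Function.iterate_succ_apply]
  obtain ⟨s, hs, hsV⟩ := Metric.isOpen_iff.1 hV x hx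
  obtain ⟨a, haO, hxa⟩ := Metric.mem_closure_iff.1 hxO (s / 4) (by positivity)
  obtain ⟨b, hb, hxb⟩ := Metric.mem_closure_iff.1 hxG (s / 4) (by positivity)
  set S := {y | y ∈ V ∧ G y ≠ y} with hS
  have haV : a ∈ V := hsV (by rw [Metric.mem_ball, dist_comm]; linarith)
  have haS : a ∉ closure S := fun h => by
    obtain ⟨y, hyO, hyS⟩ := mem_closure_iff.1 h O hO haO
    exact hyS.2 (hGO y hyO)
  obtain ⟨x₁, hx₁, hdist⟩ := isClosed_closure.exists_infDist_eq_dist ⟨x, hxG⟩ a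
  set R := dist a x₁ with hR
  have hRS : ∀ y ∈ S, R ≤ dist a y := fun y hy =>
    hdist ▸ Metric.infDist_le_dist_of_mem (subset_closure hy)
  have hR0 : 0 < R := dist_pos.2 fun h => haS (h ▸ hx₁)
  have hx₁V : x₁ ∈ V := hsV (by
    have h1 := hRS b hb
    rw [Metric.mem_ball, dist_comm]
    have h2 := dist_triangle a x b
    rw [dist_comm a x] at h2
    linarith [dist_triangle x a x₁])
  -- inversion in the sphere through `x₁`
  set I := EuclideanGeometry.inversion a R with hI
  have hII : ∀ y, I (I y) = y := EuclideanGeometry.inversion_inversion a hR0.ne'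
  have hIa : ∀ y, I y = a ↔ y = a := fun y => EuclideanGeometry.inversion_eq_center hR0.ne'
  have hIc : ContinuousOn I {a}ᶜ :=
    ContinuousOn.inversion continuousOn_const continuousOn_const continuousOn_id fun y hy => hy
  have hIx₁ : I x₁ = x₁ := EuclideanGeometry.inversion_of_mem_sphere (by
    rw [Metric.mem_sphere, dist_comm])
  have hx₁a : x₁ ≠ a := fun h => by simp [hR, h] at hR0
  set U := {a}ᶜ ∩ I ⁻¹' V with hU
  have hUo : IsOpen U := hIc.isOpen_inter_preimage isOpen_compl_singleton hV
  have hIU : ∀ y ∈ V, y ≠ a → I y ∈ U := fun y hy hne =>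
    ⟨fun h => hne ((hIa y).1 h), by rwa [Set.mem_preimage, hII]⟩
  have hGa : ∀ y ∈ V, y ≠ a → G y ≠ a := fun y hy hne h =>
    hne (hGinj y hy a haV (h.trans (hGO a haO).symm))
  have hGI : ∀ y ∈ U, G (I y) ∈ V ∧ G (I y) ≠ a := fun y hy =>
    ⟨hGV _ hy.2, hGa _ hy.2 fun h => hy.1 ((hIa y).1 h)⟩
  have hx₁U : x₁ ∈ U := ⟨hx₁a, by rwa [Set.mem_preimage, hIx₁]⟩
  have hes : ∀ z, e (e.symm z) = z := e.apply_symm_apply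
  have hse : ∀ y, e.symm (e y) = y := e.symm_apply_apply
  set G' : (Fin n → ℝ) → Fin n → ℝ := fun z => e (I (G (I (e.symm z)))) with hG'
  have hG'U : ∀ z ∈ e.symm ⁻¹' U, G' z ∈ e.symm ⁻¹' U := fun z hz => by
    rw [Set.mem_preimage, hG', hse]
    exact hIU _ (hGI _ hz).1 (hGI _ hz).2
  have hG'i : ∀ i, ∀ z, G'^[i] z = e (I (G^[i] (I (e.symm z)))) := by
    intro i z
    induction i with
    | zero => simp [hII]
    | succ i ih =>
      rw [Function.iterate_succ_apply', Function.iterate_succ_apply', ih, hG']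
      simp only
      rw [hse, hII]
  have hfree : e x₁ ∈ closure {z | z ∈ e.symm ⁻¹' U ∧ G' z ≠ z} := by
    have h1 : Filter.Tendsto (fun y => e (I y)) (nhds x₁) (nhds (e x₁)) := by
      have h2 : ContinuousAt I x₁ := hIc.continuousAt (isOpen_compl_singleton.mem_nhds hx₁a)
      rw [ContinuousAt, hIx₁] at h2
      exact (e.continuous.tendsto x₁).comp h2
    rw [mem_closure_iff_frequently] at hx₁ ⊢
    refine h1.frequently (hx₁.mono ?_)
    rintro y ⟨hyV, hyG⟩
    have hya : y ≠ a := fun h => hyG (by rw [h]; exact hGO a haO)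
    refine ⟨by rw [Set.mem_preimage, hse]; exact hIU y hyV hya, fun h => hyG ?_⟩
    simp only [hG', hse, hII] at h
    have h3 := congrArg I (e.injective h)
    rwa [hII, hII] at h3
  refine core (Θ := (fun y => dist y a ^ 2 - R ^ 2) ∘ e.symm) hp (hUo.preimage e.symm.continuous)
    hG'U ?_ ?_ ?_ (strictConvexOn_comp_equiv e.symm.toLinearEquiv (strictConvexOn_dist_sq a _)) ?_
    (x₀ := e x₁) (by rwa [Set.mem_preimage, hse]) ?_ hfree ?_
  · have h1 : ContinuousOn (fun y => I (G (I y))) U := by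
      refine hIc.comp (hGc.comp (hIc.mono Set.inter_subset_left) fun y hy => hy.2) fun y hy => ?_
      exact (hGI y hy).2
    exact e.continuous.comp_continuousOn (h1.comp e.symm.continuous.continuousOn fun z hz => hz)
  · intro z hz
    rw [hG'i, hGp _ hz.2, hII, hes]
  · exact (((continuous_id.dist continuous_const).pow 2).sub continuous_const).comp
      e.symm.continuous
  · intro z hz hne
    have h1 : R ≤ dist a (I (e.symm z)) := hRS _ ⟨hz.2, fun h => hne (by
      simp only [hG']
      rw [h, hII, hes])⟩
    have hza : 0 < dist (e.symm z) a := dist_pos.2 hz.1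
    rw [dist_comm, hI, EuclideanGeometry.dist_inversion_center, le_div_iff₀ hza] at h1
    have h2 : dist (e.symm z) a ≤ R := by nlinarith
    simp only [Function.comp_apply]
    nlinarith
  · simp only [Function.comp_apply, hse]
    rw [dist_comm, ← hR, sub_self]
  · rw [mem_closure_iff_frequently]
    have h1 : Filter.Tendsto (fun t : ℝ => e (x₁ + t • (x₁ - a))) (nhdsWithin 0 (Set.Ioi 0))
        (nhds (e x₁)) := by
      have h2 : Continuous fun t : ℝ => e (x₁ + t • (x₁ - a)) := by fun_prop
      have h3 := h2.tendsto 0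
      simp only [zero_smul, add_zero] at h3
      exact h3.mono_left nhdsWithin_le_nhds
    refine h1.frequently (Filter.Eventually.frequently ?_)
    filter_upwards [self_mem_nhdsWithin] with t ht
    rw [Set.mem_Ioi] at ht
    rw [Function.comp_apply, hse]
    have h4 : dist (x₁ + t • (x₁ - a)) a = (1 + t) * R := by
      rw [dist_eq_norm, show x₁ + t • (x₁ - a) - a = (1 + t) • (x₁ - a) by module, norm_smul,
        Real.norm_of_nonneg (by linarith), ← dist_eq_norm, dist_comm, ← hR]
    rw [h4]
    nlinarith [mul_pos ht hR0, mul_pos (mul_pos ht hR0) hR0]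

end

section

/-- A self-homeomorphism of prime period that is the identity near some point is the identity. -/
theorem eq_of_prime_period {r : ℕ} {M : Type*} [TopologicalSpace M] [T2Space M] [ConnectedSpace M]
    [ChartedSpace (EuclideanSpace ℝ (Fin r)) M] {γ : M → M} (hγ : Continuous γ) {p : ℕ}
    (hp : p.Prime) (hγp : ∀ x, γ^[p] x = x) (hint : (interior {x : M | γ x = x}).Nonempty) (x : M) :
    γ x = x := by
  set O := interior {x : M | γ x = x} with hO
  have hOγ : ∀ x ∈ O, γ x = x := fun x hx =>
    (interior_subset hx : x ∈ {x : M | γ x = x})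
  rcases (frontier O).eq_empty_or_nonempty with hfr | ⟨x₀, hx₀⟩
  · have h := ((isClopen_iff_frontier_eq_empty).2 hfr).eq_univ hint
    exact hOγ x (h ▸ Set.mem_univ x)
  exfalso
  rw [isOpen_interior.frontier_eq] at hx₀
  obtain ⟨hx₀c, hx₀O⟩ := hx₀
  have hx₀F : x₀ ∈ closure {x | γ x ≠ x} := by
    rw [show {x | γ x ≠ x} = {x : M | γ x = x}ᶜ from rfl, closure_compl]
    exact hx₀O
  set e := chartAt (EuclideanSpace ℝ (Fin r)) x₀ with he
  have hγx₀ : γ x₀ = x₀ :=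
    (isClosed_eq hγ continuous_id).closure_subset_iff.2 (fun x hx => hOγ x hx) hx₀c
  set U := ⋂ i ∈ Finset.range p, γ^[i] ⁻¹' e.source with hU
  have hUo : IsOpen U := isOpen_biInter_finset fun i _ => e.open_source.preimage (hγ.iterate i)
  have hmem : ∀ x, x ∈ U ↔ ∀ i, γ^[i] x ∈ e.source := by
    intro x
    simp only [hU, Set.mem_iInter, Finset.mem_range, Set.mem_preimage]
    refine ⟨fun h i => ?_, fun h i _ => h i⟩
    rw [← Function.IsPeriodicPt.iterate_mod_apply (hγp x)]
    exact h _ (Nat.mod_lt _ hp.pos)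
  have hUe : U ⊆ e.source := fun x hx => (hmem x).1 hx 0
  have hUγ : ∀ x ∈ U, γ x ∈ U := fun x hx =>
    (hmem _).2 fun i => by
      rw [← Function.iterate_succ_apply]
      exact (hmem x).1 hx _
  have hx₀U : x₀ ∈ U := (hmem x₀).2 fun i => by
    rw [Function.iterate_fixed hγx₀]
    exact mem_chart_source _ x₀
  set V := e.target ∩ e.symm ⁻¹' U with hV
  have hVo : IsOpen V := e.isOpen_inter_preimage_symm hUo
  have hUV : ∀ x ∈ U, e x ∈ V := fun x hx =>
    ⟨e.map_source (hUe hx), by rwa [Set.mem_preimage, e.left_inv (hUe hx)]⟩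
  set G : EuclideanSpace ℝ (Fin r) → EuclideanSpace ℝ (Fin r) := fun y => e (γ (e.symm y)) with hG
  have hGV : ∀ y ∈ V, G y ∈ V := fun y hy => hUV _ (hUγ _ hy.2)
  have hsG : ∀ y ∈ V, e.symm (G y) = γ (e.symm y) := fun y hy => e.left_inv (hUe (hUγ _ hy.2))
  have hsGi : ∀ i, ∀ y ∈ V, G^[i] y ∈ V ∧ e.symm (G^[i] y) = γ^[i] (e.symm y) := by
    intro i y hy
    induction i with
    | zero => exact ⟨hy, rfl⟩
    | succ i ih =>
      rw [Function.iterate_succ_apply', Function.iterate_succ_apply', hsG _ ih.1, ih.2]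
      exact ⟨hGV _ ih.1, rfl⟩
  have hGfix : ∀ y ∈ V, G y = y ↔ γ (e.symm y) = e.symm y := fun y hy =>
    ⟨fun h => by rw [← hsG y hy, h], fun h => by rw [hG]; simp only [h]; exact e.right_inv hy.1⟩
  have htends : Filter.Tendsto e (nhds x₀) (nhds (e x₀)) := e.continuousAt (hUe hx₀U)
  have hUx₀ := hUo.eventually_mem hx₀U
  refine euclidean_core (EuclideanSpace.equiv (Fin r) ℝ) (V := V) (O := V ∩ e.symm ⁻¹' O) (G := G)
    hp hVo hGV ?_ ?_ ?_ ?_ (hUV _ hx₀U) ?_ ?_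
  · have h1 : ContinuousOn e.symm V := e.continuousOn_symm.mono Set.inter_subset_left
    exact e.continuousOn.comp (hγ.comp_continuousOn h1) fun y hy => hUe (hUγ _ hy.2)
  · intro y hy
    have h1 := hsGi p y hy
    rw [hγp] at h1
    rw [← e.right_inv h1.1.1, h1.2, e.right_inv hy.1]
  · exact (e.continuousOn_symm.mono Set.inter_subset_left).isOpen_inter_preimage hVo isOpen_interior
  · exact fun y hy => (hGfix y hy.1).2 (hOγ _ hy.2)
  · rw [mem_closure_iff_frequently] at hx₀c ⊢
    refine htends.frequently ((hx₀c.and_eventually hUx₀).mono ?_)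
    rintro z ⟨hzO, hzU⟩
    exact ⟨hUV z hzU, by rwa [Set.mem_preimage, e.left_inv (hUe hzU)]⟩
  · rw [mem_closure_iff_frequently] at hx₀F ⊢
    refine htends.frequently ((hx₀F.and_eventually hUx₀).mono ?_)
    rintro z ⟨hzF, hzU⟩
    refine ⟨hUV z hzU, fun h => hzF ?_⟩
    have h1 := (hGfix _ (hUV z hzU)).1 h
    rwa [e.left_inv (hUe hzU)] at h1

end

end Newman

lemma homeo_pow_apply {X : Type*} [TopologicalSpace X] (g : X ≃ₜ X) (m : ℕ) (x : X) :
    (g ^ m) x = g^[m] x := by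
  induction m generalizing x with
  | zero => rfl
  | succ m ih =>
    rw [pow_succ, Function.iterate_succ_apply, ← ih]
    rfl

/-- Newman-type theorem: a finite-order self-homeomorphism of a connected
topological `r`-manifold whose fixed point set has nonempty interior is the identity. -/
theorem statement15 (r : ℕ)
    (M : Type*) [TopologicalSpace M] [T2Space M] [SecondCountableTopology M]
    [ConnectedSpace M] [ChartedSpace (EuclideanSpace ℝ (Fin r)) M]
    (g : M ≃ₜ M) (hfin : IsOfFinOrder g)
    (hint : (interior {x : M | g x = x}).Nonempty) :
    g = 1 := by
  by_contra hne
  have hord : orderOf g ≠ 1 := fun h => hne (orderOf_eq_one_iff.1 h)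
  obtain ⟨p, hp, hpd⟩ := Nat.exists_prime_and_dvd hord
  set γ := g ^ (orderOf g / p) with hγ
  have hγo : orderOf γ = p := orderOf_pow_orderOf_div hfin.orderOf_pos.ne' hpd
  have hγp : γ ^ p = 1 := hγo ▸ pow_orderOf_eq_one γ
  have hγ1 : γ = 1 := by
    refine Homeomorph.ext fun x => ?_
    refine Newman.eq_of_prime_period (r := r) γ.continuous hp (fun x => ?_)
      (hint.mono (interior_mono fun x hx => ?_)) x
    · rw [← homeo_pow_apply, hγp, homeo_one_apply]
    · rw [Set.mem_ofPred_eq] at hx ⊢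
      rw [hγ, homeo_pow_apply, Function.iterate_fixed hx]
  rw [hγ1, orderOf_one] at hγo
  exact hp.one_lt.ne hγo
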